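/- arXiv:2305.12041 — 4 statements merged into one kernel-verified Lean document; each statement's English description precedes it below -/
import Mathlib

section
/- Let r ≥ 9 be an integer and let G be a finite simple graph with maximum degree at most r that satisfies the planar edge bounds. Then G admits an equitable r-coloring. (This is Theorem 1.2, the Yap–Zhang–Nakprasit theorem, stated for planar graphs; every planar graph satisfies the planar edge bounds by Euler's formula.) -/
open scoped Classical

namespace Equitable

variable {V : Type*}

/-- An equitable `r`-coloring of `G`: a proper coloring with `r` colors whose
color classes pairwise differ in size by at most `1`. -/
def IsEquitableColoring [Fintype V] (G : SimpleGraph V) (r : ℕ) (c : V → Fin r) : Prop :=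
  (∀ u v : V, G.Adj u v → c u ≠ c v) ∧
  ∀ i j : Fin r,
    (Finset.univ.filter fun v => c v = i).card ≤
      (Finset.univ.filter fun v => c v = j).card + 1

/-- The number of edges of `G` with both endpoints in `S`. -/
noncomputable def edgesWithin [Fintype V] (G : SimpleGraph V) (S : Finset V) : ℕ :=
  (G.edgeFinset.filter fun e => ∀ v ∈ e, v ∈ S).card

/-- The number of edges of `G` with one endpoint in `X` and the other in `Y`. -/
noncomputable def edgesBetween [Fintype V] (G : SimpleGraph V) (X Y : Finset V) : ℕ :=
  (G.edgeFinset.filter fun e => ∃ u ∈ X, ∃ w ∈ Y, e = s(u, w)).card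

/-- The semi-planar edge bounds. -/
def SemiPlanarBounds [Fintype V] (G : SimpleGraph V) : Prop :=
  (∀ S : Finset V, edgesWithin G S ≤ 3 * S.card) ∧
  ∀ X Y : Finset V, Disjoint X Y → edgesBetween G X Y ≤ 2 * (X.card + Y.card)

/-- The planar edge bounds. -/
def PlanarBounds [Fintype V] (G : SimpleGraph V) : Prop :=
  (∀ S : Finset V, 3 ≤ S.card → edgesWithin G S ≤ 3 * S.card - 6) ∧
  ∀ X Y : Finset V, Disjoint X Y → 3 ≤ X.card + Y.card →
    edgesBetween G X Y ≤ 2 * (X.card + Y.card) - 4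

/-- The semi-planar bipartite edge bound. -/
def SemiPlanarBipBound [Fintype V] (G : SimpleGraph V) : Prop :=
  ∀ X Y : Finset V, Disjoint X Y → edgesBetween G X Y ≤ 2 * (X.card + Y.card)

/-- The planar bipartite edge bound. -/
def PlanarBipBound [Fintype V] (G : SimpleGraph V) : Prop :=
  ∀ X Y : Finset V, Disjoint X Y → 3 ≤ X.card + Y.card →
    edgesBetween G X Y ≤ 2 * (X.card + Y.card) - 4

/-- `P` is an almost equitable coloring of `G − x`: a partition of `V(G) \ {x}` into `r`
independent sets, the small class `P 0` of size `s − 1` and the other classes of size `s`. -/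
def AEColoring [Fintype V] (G : SimpleGraph V) (x : V) {r : ℕ} [NeZero r] (s : ℕ)
    (P : Fin r → Finset V) : Prop :=
  (∀ i j : Fin r, i ≠ j → Disjoint (P i) (P j)) ∧
  (∀ v : V, (∃ i, v ∈ P i) ↔ v ≠ x) ∧
  (∀ i : Fin r, ∀ u ∈ P i, ∀ w ∈ P i, ¬ G.Adj u w) ∧
  (P 0).card = s - 1 ∧
  ∀ i : Fin r, i ≠ 0 → (P i).card = s

/-- The arc relation of the auxiliary digraph `H`: an arc from class `i` to class `j`
iff `i ≠ j` and some vertex of `P i` has no `G`-neighbor in `P j` (such a vertex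
is a witness of the arc and is called movable to `P j`). -/
def Arc (G : SimpleGraph V) {r : ℕ} (P : Fin r → Finset V) (i j : Fin r) : Prop :=
  i ≠ j ∧ ∃ v ∈ P i, ∀ u ∈ P j, ¬ G.Adj v u

/-- A class is accessible if the auxiliary digraph has a directed path (possibly of
length `0`) from it to the small class `P 0`. -/
def Accessible (G : SimpleGraph V) {r : ℕ} [NeZero r] (P : Fin r → Finset V)
    (i : Fin r) : Prop :=
  Relation.ReflTransGen (Arc G P) i 0

/-- The number of accessible classes. -/
noncomputable def accCount (G : SimpleGraph V) {r : ℕ} [NeZero r]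
    (P : Fin r → Finset V) : ℕ :=
  (Finset.univ.filter fun i => Accessible G P i).card

/-- No almost equitable coloring of `G − x` has more accessible classes than `P`. -/
def MaxAccessible [Fintype V] (G : SimpleGraph V) (x : V) {r : ℕ} [NeZero r] (s : ℕ)
    (P : Fin r → Finset V) : Prop :=
  ∀ P' : Fin r → Finset V, AEColoring G x s P' → accCount G P' ≤ accCount G P

/-- Class `i` blocks class `j` if `i ≠ j` and the auxiliary digraph minus the
class `i` has no directed path from `j` to the small class `P 0`. -/
def Blocks (G : SimpleGraph V) {r : ℕ} [NeZero r] (P : Fin r → Finset V)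
    (i j : Fin r) : Prop :=
  i ≠ j ∧ ¬ Relation.ReflTransGen (fun p q => Arc G P p q ∧ p ≠ i ∧ q ≠ i) j 0

/-- An accessible class is terminal if it blocks no accessible class. -/
def Terminal (G : SimpleGraph V) {r : ℕ} [NeZero r] (P : Fin r → Finset V)
    (i : Fin r) : Prop :=
  Accessible G P i ∧ ∀ j : Fin r, Accessible G P j → ¬ Blocks G P i j

/-- `u` is a solo neighbor of `v` (where `v` lies in the accessible class `P i`):
`u` lies in a non-accessible class, is adjacent to `v`, and `v` is the unique
neighbor of `u` in `P i`.  `Q(v)` is the set of such `u`. -/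
def SoloNbr (G : SimpleGraph V) {r : ℕ} [NeZero r] (P : Fin r → Finset V)
    (i : Fin r) (v u : V) : Prop :=
  (∃ k : Fin r, ¬ Accessible G P k ∧ u ∈ P k) ∧ G.Adj v u ∧
    ∀ w ∈ P i, G.Adj u w → w = v

/-- `u ∈ Q'(v)`: `u` is a solo neighbor of `v` that is non-adjacent to some other
solo neighbor of `v`. -/
def InQ' (G : SimpleGraph V) {r : ℕ} [NeZero r] (P : Fin r → Finset V)
    (i : Fin r) (v u : V) : Prop :=
  SoloNbr G P i v u ∧ ∃ u' : V, SoloNbr G P i v u' ∧ u' ≠ u ∧ ¬ G.Adj u u'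

/-- A vertex `v` of a terminal accessible class `P i` is ordinary if some other vertex of
`P i` is movable to another accessible class, or there are at most two accessible classes. -/
def Ordinary (G : SimpleGraph V) {r : ℕ} [NeZero r] (P : Fin r → Finset V)
    (i : Fin r) (v : V) : Prop :=
  (∃ v' ∈ P i, v' ≠ v ∧
    ∃ j : Fin r, j ≠ i ∧ Accessible G P j ∧ ∀ w ∈ P j, ¬ G.Adj v' w) ∨
  accCount G P ≤ 2

/-- The strong component of the auxiliary digraph containing class `i`. -/
noncomputable def strongComp (G : SimpleGraph V) {r : ℕ} (P : Fin r → Finset V)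
    (i : Fin r) : Finset (Fin r) :=
  Finset.univ.filter fun j =>
    Relation.ReflTransGen (Arc G P) i j ∧ Relation.ReflTransGen (Arc G P) j i

section Proof

/-- From the last visit to its starting point on, a path does not return to that point. -/
theorem exists_last_exit {α : Type*} {R : α → α → Prop} {j i : α}
    (h : Relation.ReflTransGen R j i) (hne : j ≠ i) :
    ∃ k, R j k ∧ Relation.ReflTransGen (fun p q => R p q ∧ p ≠ j ∧ q ≠ j) k i := by
  have no_start : ¬ Relation.ReflTransGen (fun p q => R p q ∧ p ≠ j ∧ q ≠ j) j i := by
    intro h'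
    rcases h'.cases_head with h' | ⟨k, hk, -⟩
    · exact hne h'
    · exact hk.2.1 rfl
  have key : ∀ m, Relation.ReflTransGen R m i →
      Relation.ReflTransGen (fun p q => R p q ∧ p ≠ j ∧ q ≠ j) m i ∨
        ∃ k, R j k ∧ Relation.ReflTransGen (fun p q => R p q ∧ p ≠ j ∧ q ≠ j) k i := by
    intro m hm
    induction hm using Relation.ReflTransGen.head_induction_on with
    | refl => exact Or.inl .refl
    | @head m k hmk _ ih =>
      rcases ih with ih | ih
      · by_cases hm : m = j
        · exact Or.inr ⟨k, hm ▸ hmk, ih⟩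
        · by_cases hk : k = j
          · exact absurd (hk ▸ ih) no_start
          · exact Or.inl (.head ⟨hmk, hm, hk⟩ ih)
      · exact Or.inr ih
  exact (key j h).resolve_left no_start

variable {r : ℕ}

/-- A vertex `v` that may conflict with its own color is moved to the color `j`, and the hole it
leaves is filled by shifting vertices along a path of colors from `j` to the old color of `v`. -/
theorem exists_perm_shift (K : SimpleGraph V) (F : Finset (Fin r)) (c : V → Fin r) (v : V)
    (j : Fin r) (hc : ∀ a b, K.Adj a b → a ≠ v → b ≠ v → c a ≠ c b)
    (hj : ∀ b, K.Adj v b → c b ≠ j)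
    (hp : Relation.ReflTransGen (fun p q => (p ≠ q ∧ ∃ z, z ≠ v ∧ c z = p ∧
      ∀ b, b ≠ v → K.Adj z b → c b ≠ q) ∧ p ∉ F ∧ q ∉ F ∧ p ≠ c v) j (c v))
    (hF : c v ∉ F) :
    ∃ σ : Equiv.Perm V, (∀ a b, K.Adj a b → c (σ a) ≠ c (σ b)) ∧
      ∀ f ∈ F, ∀ z, c (σ z) = f ↔ c z = f := by
  induction hn : Fᶜ.card using Nat.strong_induction_on generalizing F c v j with
  | _ n ih =>
  by_cases hjv : j = c v
  · refine ⟨1, fun a b hab => ?_, fun f _ z => Iff.rfl⟩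
    simp only [Equiv.Perm.coe_one, id_eq]
    by_cases ha : a = v
    · subst ha
      exact hjv ▸ (hj b hab).symm
    by_cases hb : b = v
    · subst hb
      exact hjv ▸ hj a hab.symm
    exact hc a b hab ha hb
  obtain ⟨k, ⟨⟨hjk, z, hzv, hzj, hz⟩, hjF, hkF, -⟩, hpath⟩ := exists_last_exit hp hjv
  have hcz : ∀ b, b ≠ z → b ≠ v → c (Equiv.swap z v b) = c b := fun b h1 h2 => by
    rw [Equiv.swap_apply_of_ne_of_ne h1 h2]
  have hczz : c (Equiv.swap z v z) = c v := by rw [Equiv.swap_apply_left]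
  have hczv : c (Equiv.swap z v v) = j := by rw [Equiv.swap_apply_right, hzj]
  obtain ⟨σ, hσ, hσF⟩ := ih (insert j F)ᶜ.card (by
      rw [← hn]
      apply Finset.card_lt_card
      rw [Finset.compl_ssubset_compl]
      exact Finset.ssubset_insert hjF) (insert j F) (fun b => c (Equiv.swap z v b)) z k
    (by
      intro a b hab ha hb
      by_cases hav : a = v
      · subst hav
        rw [hczv, hcz b hb hab.ne.symm]
        exact (hj b hab).symm
      by_cases hbv : b = v
      · subst hbv
        rw [hczv, hcz a ha hab.ne]
        exact hj a hab.symm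
      rw [hcz a ha hav, hcz b hb hbv]
      exact hc a b hab hav hbv)
    (by
      intro b hb
      by_cases hbv : b = v
      · subst hbv
        rwa [hczv]
      · rw [hcz b hb.ne.symm hbv]
        exact hz b hbv hb)
    (by
      simp only [hczz]
      refine Relation.ReflTransGen.mono ?_ _ _ hpath
      rintro p q ⟨⟨⟨hpq, y, hyv, hyp, hy⟩, hpF, hqF, hpv⟩, hpj, hqj⟩
      have hyz : y ≠ z := by
        rintro rfl
        exact hpj (hyp.symm.trans hzj)
      refine ⟨⟨hpq, y, hyz, by rw [hcz y hyz hyv, hyp], fun b hbz hyb => ?_⟩, ?_, ?_, hpv⟩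
      · by_cases hbv : b = v
        · subst hbv
          rw [hczv]
          exact hqj.symm
        · rw [hcz b hbz hbv]
          exact hy b hbv hyb
      · simp [hpj, hpF]
      · simp [hqj, hqF])
    (by
      rw [hczz]
      simp only [Finset.mem_insert, not_or]
      exact ⟨fun h => hjv h.symm, hF⟩) rfl
  refine ⟨Equiv.swap z v * σ, hσ, fun f hf y => ?_⟩
  have h1 := hσF f (Finset.mem_insert_of_mem hf) y
  simp only [Equiv.Perm.coe_mul, Function.comp_apply]
  rw [h1]
  by_cases hyz : y = z
  · subst hyz
    rw [hczz, hzj]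
    constructor
    · intro h; exact absurd (h ▸ hf) hF
    · intro h; exact absurd (h ▸ hf) hjF
  by_cases hyv : y = v
  · subst hyv
    rw [hczv]
    constructor
    · intro h; exact absurd (h ▸ hf) hjF
    · intro h; exact absurd (h ▸ hf) hF
  rw [hcz y hyz hyv]

/-- A proper coloring of `K` all of whose color classes have exactly `s` vertices. -/
def IsExactColoring [Fintype V] (K : SimpleGraph V) (s : ℕ) (c : V → Fin r) : Prop :=
  (∀ a b, K.Adj a b → c a ≠ c b) ∧ ∀ i, (Finset.univ.filter fun v => c v = i).card = s

/-- Some vertex of color `p` other than `x` has no neighbor of color `q`. -/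
def ColorArc (K : SimpleGraph V) (x : V) (c : V → Fin r) (p q : Fin r) : Prop :=
  p ≠ q ∧ ∃ z, z ≠ x ∧ c z = p ∧ ∀ b, K.Adj z b → c b ≠ q

/-- The color of `x` can be reached from `i` along arcs. -/
def ColorAcc (K : SimpleGraph V) (x : V) (c : V → Fin r) (i : Fin r) : Prop :=
  Relation.ReflTransGen (ColorArc K x c) i (c x)

theorem IsExactColoring.comp_perm [Fintype V] {K K' : SimpleGraph V} {s : ℕ} {c : V → Fin r}
    (hc : IsExactColoring K s c) (σ : Equiv.Perm V)
    (hσ : ∀ a b, K'.Adj a b → c (σ a) ≠ c (σ b)) :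
    IsExactColoring K' s fun v => c (σ v) := by
  refine ⟨hσ, fun i => ?_⟩
  rw [← hc.2 i]
  refine Finset.card_bij (fun v _ => σ v) (by simp) (by simp) fun b hb => ⟨σ.symm b, ?_, ?_⟩
  · simpa using hb
  · simp

/-- Paths can be cut at their first visit to the end point and confined to the complement of a
set that has no incoming arcs. -/
theorem reflTransGen_restrict {α : Type*} {R : α → α → Prop} {F : Finset α} {j i : α}
    (h : Relation.ReflTransGen R j i) (hF : ∀ p q, R p q → p ∉ F → q ∉ F) (hj : j ∉ F) :
    i ∉ F ∧ Relation.ReflTransGen (fun p q => R p q ∧ p ∉ F ∧ q ∉ F ∧ p ≠ i) j i := by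
  induction h using Relation.ReflTransGen.head_induction_on with
  | refl => exact ⟨hj, .refl⟩
  | @head p q hpq _ ih =>
    have hq := hF p q hpq hj
    refine ⟨(ih hq).1, ?_⟩
    by_cases hpi : p = i
    · rw [hpi]
    · exact .head ⟨hpq, hj, hq, hpi⟩ (ih hq).2

/-- If `v` is the only neighbor of `u` in the color class of `v`, then `u` can take the color of
`v` provided that `v` fits into a color class from which that of `u` can be reached. -/
theorem exists_exchange [Fintype V] {K : SimpleGraph V} {x : V} {s : ℕ} {c : V → Fin r}
    (hc : IsExactColoring K s c) {F : Finset (Fin r)}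
    (hF : ∀ p q, ColorArc K x c p q → p ∉ F → q ∉ F) {u v : V} {j : Fin r}
    (hv : c v ∈ F) (hj : j ∉ F) (hreach : Relation.ReflTransGen (ColorArc K x c) j (c u))
    (hsolo : ∀ b, K.Adj u b → c b = c v → b = v)
    (hfit : ∀ b, K.Adj v b → c b = j → b = u) :
    ∃ c' : V → Fin r, IsExactColoring K s c' ∧
      (∀ z, c' z = c v ↔ (c z = c v ∧ z ≠ v) ∨ z = u) ∧
      ∀ f ∈ F, f ≠ c v → ∀ z, c' z = f ↔ c z = f := by
  obtain ⟨huF, hpath⟩ := reflTransGen_restrict hreach hF hj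
  have huv : u ≠ v := by
    rintro rfl
    exact huF hv
  have hcz : ∀ b, b ≠ u → b ≠ v → c (Equiv.swap u v b) = c b := fun b h1 h2 => by
    rw [Equiv.swap_apply_of_ne_of_ne h1 h2]
  have hczu : c (Equiv.swap u v u) = c v := by rw [Equiv.swap_apply_left]
  have hczv : c (Equiv.swap u v v) = c u := by rw [Equiv.swap_apply_right]
  obtain ⟨σ, hσ, hσF⟩ := exists_perm_shift K F (fun b => c (Equiv.swap u v b)) v j
    (by
      intro a b hab ha hb
      by_cases hau : a = u
      · subst hau
        rw [hczu, hcz b hab.ne.symm hb]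
        exact fun h => hb (hsolo b hab h.symm)
      by_cases hbu : b = u
      · subst hbu
        rw [hczu, hcz a hau ha]
        exact fun h => ha (hsolo a hab.symm h)
      rw [hcz a hau ha, hcz b hbu hb]
      exact hc.1 a b hab)
    (by
      intro b hb
      by_cases hbu : b = u
      · subst hbu
        rw [hczu]
        rintro rfl
        exact hj hv
      · rw [hcz b hbu hb.ne.symm]
        exact fun h => hbu (hfit b hb h))
    (by
      simp only [hczv]
      refine Relation.ReflTransGen.mono ?_ _ _ hpath
      rintro p q ⟨⟨hpq, z, -, hzp, hz⟩, hpF, hqF, hpu⟩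
      have hzu : z ≠ u := by
        rintro rfl
        exact hpu hzp.symm
      have hzv : z ≠ v := by
        rintro rfl
        exact hpF (hzp ▸ hv)
      refine ⟨⟨hpq, z, hzv, by rw [hcz z hzu hzv, hzp], fun b hbv hzb => ?_⟩, hpF, hqF, hpu⟩
      by_cases hbu : b = u
      · subst hbu
        rw [hczu]
        rintro rfl
        exact hqF hv
      · rw [hcz b hbu hbv]
        exact hz b hzb)
    (by rwa [hczv])
  refine ⟨_, hc.comp_perm (Equiv.swap u v * σ) hσ, fun z => ?_, fun f hf hfv z => ?_⟩
  · have h1 := hσF _ hv z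
    simp only [Equiv.Perm.coe_mul, Function.comp_apply]
    rw [h1]
    by_cases hzu : z = u
    · subst hzu
      simp
    by_cases hzv : z = v
    · subst hzv
      rw [hczv]
      simp only [ne_eq, not_true_eq_false, and_false, hzu, or_self, iff_false]
      intro h
      exact huF (h ▸ hv)
    rw [hcz z hzu hzv]
    simp [hzu, hzv]
  · have h1 := hσF _ hf z
    simp only [Equiv.Perm.coe_mul, Function.comp_apply]
    rw [h1]
    by_cases hzu : z = u
    · subst hzu
      rw [hczu]
      exact ⟨fun h => absurd h.symm hfv, fun h => absurd (h ▸ hf) huF⟩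
    by_cases hzv : z = v
    · subst hzv
      rw [hczv]
      exact ⟨fun h => absurd (h ▸ hf) huF, fun h => absurd h.symm hfv⟩
    rw [hcz z hzu hzv]

/-- The edge bound for bipartite subgraphs of planar graphs. -/
def BipBound (K : SimpleGraph V) : Prop :=
  ∀ X Y : Finset V, Disjoint X Y → 3 ≤ X.card + Y.card →
    (K.interedges X Y).card + 4 ≤ 2 * (X.card + Y.card)

theorem BipBound.mono {G K : SimpleGraph V} (hG : BipBound G) (h : K ≤ G) : BipBound K := by
  intro X Y hXY h3
  refine le_trans ?_ (hG X Y hXY h3)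
  gcongr
  intro e he
  rw [SimpleGraph.mem_interedges_iff] at he ⊢
  exact ⟨he.1, he.2.1, h he.2.2⟩

theorem IsExactColoring.card_eq [Fintype V] {K : SimpleGraph V} {s : ℕ} {c : V → Fin r}
    (hc : IsExactColoring K s c) (X : Finset (Fin r)) :
    (Finset.univ.filter fun v => c v ∈ X).card = X.card * s := by
  rw [Finset.card_eq_sum_card_fiberwise (f := c) (t := X) (by intro v hv; simpa using hv)]
  rw [Finset.sum_const_nat (m := s)]
  intro i hi
  rw [← hc.2 i]
  congr 1
  ext v
  simp only [Finset.mem_filter, Finset.mem_univ, true_and, and_iff_right_iff_imp]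
  rintro rfl
  exact hi

/-- A set of colors such that every color inside and every color outside span many edges is
small or has a small complement. -/
theorem IsExactColoring.card_le_two_or [Fintype V] {K : SimpleGraph V} {s : ℕ} {c : V → Fin r}
    (hc : IsExactColoring K s c) (hB : BipBound K) (hr : 9 ≤ r) (hs : 0 < s)
    (X : Finset (Fin r)) (hX : ∀ i ∈ X, ∀ j ∉ X, s ≤ (K.interedges
      (Finset.univ.filter fun v => c v = i) (Finset.univ.filter fun v => c v = j)).card) :
    X.card ≤ 2 ∨ r ≤ X.card + 2 := by
  by_contra! hcon
  obtain ⟨h1, h2⟩ := hcon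
  have hXc : X.card + Xᶜ.card = r := by simp [Finset.card_add_card_compl]
  have hdisj : Disjoint (Finset.univ.filter fun v => c v ∈ X)
      (Finset.univ.filter fun v => c v ∈ Xᶜ) := by
    rw [Finset.disjoint_filter]
    intro v _ h
    simpa using h
  have hub := hB _ _ hdisj (by
    rw [hc.card_eq, hc.card_eq]
    nlinarith)
  rw [hc.card_eq, hc.card_eq] at hub
  have hlb : (X.card * Xᶜ.card) * s ≤ (K.interedges (Finset.univ.filter fun v => c v ∈ X)
      (Finset.univ.filter fun v => c v ∈ Xᶜ)).card := by
    rw [Finset.card_eq_sum_card_fiberwise (f := fun e : V × V => (c e.1, c e.2))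
      (s := K.interedges _ _) (t := X ×ˢ Xᶜ)]
    · rw [← Finset.card_product, ← smul_eq_mul]
      refine Finset.card_nsmul_le_sum _ _ _ ?_
      rintro ⟨i, j⟩ hij
      rw [Finset.mem_product, Finset.mem_compl] at hij
      refine (hX i hij.1 j hij.2).trans (Finset.card_le_card ?_)
      intro e he
      simp only [SimpleGraph.mem_interedges_iff, Finset.mem_filter, Finset.mem_univ,
        true_and, Finset.mem_compl, Prod.mk.injEq] at he ⊢
      obtain ⟨rfl, rfl, he⟩ := he
      exact ⟨⟨hij.1, hij.2, he⟩, rfl, rfl⟩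
    · intro e he
      simp only [SimpleGraph.mem_interedges_iff, Finset.mem_filter, Finset.mem_univ,
        true_and, Finset.mem_coe, Finset.mem_product] at he ⊢
      exact ⟨he.1, he.2.1⟩
  have h3 : 2 * (X.card + Xᶜ.card) ≤ X.card * Xᶜ.card := by
    obtain ⟨a, ha⟩ := Nat.exists_eq_add_of_le (show 3 ≤ X.card by omega)
    obtain ⟨b, hb⟩ := Nat.exists_eq_add_of_le (show 3 ≤ Xᶜ.card by omega)
    rw [ha, hb] at hXc ⊢
    nlinarith [Nat.zero_le (a * b)]
  nlinarith [Nat.mul_le_mul_right s h3]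

/-- The vertices of `S` whose only neighbor in `A` is `w`. -/
noncomputable def soloSet (K : SimpleGraph V) (A S : Finset V) (w : V) : Finset V :=
  S.filter fun u => K.Adj w u ∧ ∀ b ∈ A, K.Adj b u → b = w

/-- The vertices of `Q` that are not adjacent to all other vertices of `Q`. -/
noncomputable def nonDominating (K : SimpleGraph V) (Q : Finset V) : Finset V :=
  Q.filter fun u => ∃ u' ∈ Q, u' ≠ u ∧ ¬ K.Adj u u'

theorem two_mul_card_le_sum (K : SimpleGraph V) (A S : Finset V)
    (h : ∀ u ∈ S, ∃ w ∈ A, K.Adj w u) :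
    2 * S.card ≤ ∑ w ∈ A, ((soloSet K A S w).card + (S.filter (K.Adj w)).card) := by
  have h1 : ∑ w ∈ A, ((soloSet K A S w).card + (S.filter (K.Adj w)).card) =
      ∑ u ∈ S, ((A.filter fun w => K.Adj w u ∧ ∀ b ∈ A, K.Adj b u → b = w).card +
        (A.filter fun w => K.Adj w u).card) := by
    simp only [soloSet, Finset.sum_add_distrib, Finset.card_filter]
    rw [Finset.sum_comm]
    congr 1
    rw [Finset.sum_comm]
  rw [h1, mul_comm, ← smul_eq_mul]
  refine Finset.card_nsmul_le_sum _ _ _ fun u hu => ?_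
  obtain ⟨w, hwA, hwu⟩ := h u hu
  have hw : w ∈ A.filter fun w => K.Adj w u := by simp [hwA, hwu]
  by_cases hall : ∀ b ∈ A, K.Adj b u → b = w
  · have h2 : w ∈ A.filter fun w => K.Adj w u ∧ ∀ b ∈ A, K.Adj b u → b = w := by
      simp only [Finset.mem_filter]
      exact ⟨hwA, hwu, hall⟩
    have := Finset.card_pos.2 ⟨w, hw⟩
    have := Finset.card_pos.2 ⟨w, h2⟩
    omega
  · push Not at hall
    obtain ⟨b, hb, hbu, hbw⟩ := hall
    have : 1 < (A.filter fun w => K.Adj w u).card :=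
      Finset.one_lt_card.2 ⟨b, by simp [hb, hbu], w, hw, hbw⟩
    omega

/-- At most one vertex of a large set of neighbors of `w` dominates that set, because the graph
contains no `K_{3,3}`. -/
theorem BipBound.card_le_nonDominating {K : SimpleGraph V} (hB : BipBound K) (w : V)
    (Q : Finset V) (hQ : ∀ u ∈ Q, K.Adj w u) (h5 : 5 ≤ Q.card) :
    Q.card ≤ (nonDominating K Q).card + 1 := by
  by_contra! hcon
  have h1 : (Q \ nonDominating K Q).card + (nonDominating K Q).card = Q.card :=
    Finset.card_sdiff_add_card_eq_card (Finset.filter_subset _ _)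
  obtain ⟨a, ha, b, hb, hab⟩ := Finset.one_lt_card.1
    (show 1 < (Q \ nonDominating K Q).card by omega)
  have hdom : ∀ a ∈ Q \ nonDominating K Q, ∀ u ∈ Q, u ≠ a → K.Adj a u := by
    intro a ha u hu hua
    simp only [nonDominating, Finset.mem_sdiff, Finset.mem_filter, not_and, not_exists,
      not_not] at ha
    exact ha.2 ha.1 u hu hua
  have haQ := (Finset.mem_sdiff.1 ha).1
  have hbQ := (Finset.mem_sdiff.1 hb).1
  have h2 : 3 ≤ ((Q.erase a).erase b).card := by
    rw [Finset.card_erase_of_mem (Finset.mem_erase.2 ⟨hab.symm, hbQ⟩),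
      Finset.card_erase_of_mem haQ]
    omega
  obtain ⟨Y, hY, hY3⟩ := Finset.exists_subset_card_eq h2
  have hwa : w ≠ a := (hQ a haQ).ne
  have hwb : w ≠ b := (hQ b hbQ).ne
  have hX3 : ({w, a, b} : Finset V).card = 3 := Finset.card_eq_three.2 ⟨w, a, b, hwa, hwb, hab, rfl⟩
  have hadj : ∀ p ∈ ({w, a, b} : Finset V), ∀ y ∈ Y, K.Adj p y := by
    intro p hp y hy
    have hy' := hY hy
    simp only [Finset.mem_erase] at hy'
    simp only [Finset.mem_insert, Finset.mem_singleton] at hp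
    rcases hp with rfl | rfl | rfl
    · exact hQ y hy'.2.2
    · exact hdom _ ha y hy'.2.2 hy'.2.1
    · exact hdom _ hb y hy'.2.2 hy'.1
  have hdisj : Disjoint ({w, a, b} : Finset V) Y := by
    rw [Finset.disjoint_left]
    intro p hp hpY
    exact (hadj p hp p hpY).ne rfl
  have h3 := hB _ _ hdisj (by omega)
  have h4 : K.interedges ({w, a, b} : Finset V) Y = ({w, a, b} : Finset V) ×ˢ Y := by
    ext ⟨p, y⟩
    rw [SimpleGraph.mk_mem_interedges_iff, Finset.mem_product]
    exact ⟨fun h => ⟨h.1, h.2.1⟩, fun h => ⟨h.1, h.2, hadj p h.1 y h.2⟩⟩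
  rw [h4, Finset.card_product, hX3, hY3] at h3
  omega

/-- If `N` is small compared to the number of colors and `Q ⊆ N` is large, some color is
missing on `N` or appears on `N` just once, at a vertex of `Q`. -/
theorem exists_color_missing_or_unique (c : V → Fin r) {N Q : Finset V} (hQN : Q ⊆ N)
    (T : Finset (Fin r)) (hcard : 2 * N.card < Q.card + 2 * T.card) :
    ∃ j ∈ T, (∀ b ∈ N, c b ≠ j) ∨ ∃ u ∈ Q, c u = j ∧ ∀ b ∈ N, c b = j → b = u := by
  by_contra! hcon
  have hsum : ∑ j : Fin r, ((if j ∈ T then 2 else 0) + (Q.filter fun b => c b = j).card) ≤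
      ∑ j : Fin r, 2 * (N.filter fun b => c b = j).card := by
    refine Finset.sum_le_sum fun j _ => ?_
    have hle : (Q.filter fun b => c b = j).card ≤ (N.filter fun b => c b = j).card :=
      Finset.card_le_card (Finset.filter_subset_filter _ hQN)
    split_ifs with hj
    · obtain ⟨⟨b, hbN, hbj⟩, hu⟩ := hcon j hj
      have hpos : 0 < (N.filter fun b => c b = j).card := Finset.card_pos.2 ⟨b, by simp [hbN, hbj]⟩
      rcases (Q.filter fun b => c b = j).eq_empty_or_nonempty with h0 | ⟨u, huQ⟩
      · rw [h0, Finset.card_empty]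
        omega
      · rw [Finset.mem_filter] at huQ
        obtain ⟨b', hb'N, hb'j, hb'u⟩ := hu u huQ.1 huQ.2
        have : 1 < (N.filter fun b => c b = j).card :=
          Finset.one_lt_card.2 ⟨b', by simp [hb'N, hb'j], u, by simp [hQN huQ.1, huQ.2], hb'u⟩
        omega
    · omega
  rw [Finset.sum_add_distrib, ← Finset.mul_sum,
    ← Finset.card_eq_sum_card_fiberwise (fun _ _ => Finset.mem_coe.2 (Finset.mem_univ _)),
    ← Finset.card_eq_sum_card_fiberwise (fun _ _ => Finset.mem_coe.2 (Finset.mem_univ _))] at hsum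
  simp only [Finset.sum_ite_mem, Finset.univ_inter, Finset.sum_const, smul_eq_mul] at hsum
  omega

section Core

variable {K : SimpleGraph V} {x : V} {s : ℕ} {c : V → Fin r}

/-- The accessible colors. -/
noncomputable def accSet (K : SimpleGraph V) (x : V) (c : V → Fin r) : Finset (Fin r) :=
  Finset.univ.filter (ColorAcc K x c)

theorem mem_accSet {i : Fin r} : i ∈ accSet K x c ↔ ColorAcc K x c i := by simp [accSet]

theorem exists_adj_of_not_colorArc {p q : Fin r} (hpq : p ≠ q) (h : ¬ ColorArc K x c p q)
    {z : V} (hzx : z ≠ x) (hz : c z = p) : ∃ b, K.Adj z b ∧ c b = q := by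
  by_contra! hcon
  exact h ⟨hpq, z, hzx, hz, hcon⟩

theorem colorAcc_of_colorArc {p q : Fin r} (h : ColorArc K x c p q) (hq : ColorAcc K x c q) :
    ColorAcc K x c p :=
  .head h hq

theorem card_accSet_gt_two {i j : Fin r} (hi : i ≠ c x) (hj : j ≠ c x) (hij : i ≠ j)
    (hia : ColorAcc K x c i) (hja : ColorAcc K x c j) : 2 < (accSet K x c).card :=
  Finset.two_lt_card.2 ⟨i, mem_accSet.2 hia, j, mem_accSet.2 hja, c x, mem_accSet.2 .refl,
    hij, hi, hj⟩

variable [Fintype V]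

theorem IsExactColoring.le_card_interedges (hc : IsExactColoring K s c) {p q : Fin r}
    (hpq : p ≠ q) (h : ¬ ColorArc K x c p q) (hp : p ≠ c x) :
    s ≤ (K.interedges (Finset.univ.filter fun v => c v = p)
      (Finset.univ.filter fun v => c v = q)).card := by
  rw [← hc.2 p]
  refine Finset.card_le_card_of_surjOn Prod.fst ?_
  intro z hz
  simp only [Finset.coe_filter, Finset.mem_univ, true_and, Set.mem_ofPred_eq] at hz
  obtain ⟨b, hzb, hb⟩ := exists_adj_of_not_colorArc hpq h (by rintro rfl; exact hp hz.symm) hz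
  exact ⟨(z, b), by simp [SimpleGraph.mem_interedges_iff, hz, hb, hzb], rfl⟩

/-- A union of classes of mutually reachable colors is small or has a small complement; here all
accessible colors count as one class. -/
theorem IsExactColoring.card_le_two_or_of_union (hc : IsExactColoring K s c) (hB : BipBound K)
    (hr : 9 ≤ r) (X : Finset (Fin r))
    (h1 : ∀ i ∈ X, ∀ j ∉ X, ColorAcc K x c i → ¬ ColorAcc K x c j)
    (h2 : ∀ i ∈ X, ∀ j ∉ X, ColorArc K x c i j → ¬ ColorArc K x c j i) :
    X.card ≤ 2 ∨ r ≤ X.card + 2 := by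
  have : Std.Symm K.Adj := ⟨fun _ _ h => h.symm⟩
  have hs : 0 < s := by
    rw [← hc.2 (c x)]
    exact Finset.card_pos.2 ⟨x, by simp⟩
  have hx : ∀ i, ¬ ColorAcc K x c i → i ≠ c x := by
    rintro _ h rfl
    exact h .refl
  refine hc.card_le_two_or hB hr hs X fun i hi j hj => ?_
  have hij : i ≠ j := by
    rintro rfl
    exact hj hi
  by_cases hai : ColorAcc K x c i
  · have haj := h1 i hi j hj hai
    rw [SimpleGraph.interedges, Rel.card_interedges_comm]
    exact hc.le_card_interedges hij.symm (fun h => haj (colorAcc_of_colorArc h hai)) (hx j haj)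
  by_cases hji : ColorArc K x c j i
  · have hij' : ¬ ColorArc K x c i j := fun h => h2 i hi j hj h hji
    exact hc.le_card_interedges hij hij' (hx i hai)
  by_cases haj : ColorAcc K x c j
  · exact hc.le_card_interedges hij (fun h => hai (colorAcc_of_colorArc h haj)) (hx i hai)
  · rw [SimpleGraph.interedges, Rel.card_interedges_comm]
    exact hc.le_card_interedges hij.symm hji (hx j haj)

/-- Outside a set of at most two colors, all colors reach each other. -/
theorem IsExactColoring.exists_strong (hc : IsExactColoring K s c) (hB : BipBound K)
    (hr : 9 ≤ r) (ha : (accSet K x c).card ≤ 2) :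
    ∃ W, W ≠ c x ∧ (∀ i, ColorAcc K x c i → i = c x ∨ i = W) ∧
      ∀ i j, i ≠ c x → i ≠ W → j ≠ c x → j ≠ W → Relation.ReflTransGen (ColorArc K x c) i j := by
  set R := Relation.ReflTransGen (ColorArc K x c) with hR
  have hacc : ∀ {i j}, R i j → ColorAcc K x c j → ColorAcc K x c i := fun h h' => h.trans h'
  set U : Finset (Fin r) → Prop := fun X =>
    (∀ i ∈ X, ∀ j ∉ X, ColorAcc K x c i → ¬ ColorAcc K x c j) ∧
      ∀ i ∈ X, ∀ j ∉ X, R i j → ¬ R j i with hU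
  have hUcard : ∀ X, U X → X.card ≤ 2 ∨ r ≤ X.card + 2 := fun X hX =>
    hc.card_le_two_or_of_union hB hr X hX.1 fun i hi j hj hij hji =>
      hX.2 i hi j hj (.single hij) (.single hji)
  have hUunion : ∀ X Y, U X → U Y → U (X ∪ Y) := by
    intro X Y hX hY
    constructor
    · intro i hi j hj
      rw [Finset.mem_union, not_or] at hj
      rcases Finset.mem_union.1 hi with hi | hi
      · exact hX.1 i hi j hj.1
      · exact hY.1 i hi j hj.2
    · intro i hi j hj
      rw [Finset.mem_union, not_or] at hj
      rcases Finset.mem_union.1 hi with hi | hi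
      · exact hX.2 i hi j hj.1
      · exact hY.2 i hi j hj.2
  have hUacc : U (accSet K x c) := by
    refine ⟨fun i _ j hj _ h => hj (mem_accSet.2 h), fun i hi j hj _ hji => ?_⟩
    exact hj (mem_accSet.2 (hacc hji (mem_accSet.1 hi)))
  set L : Fin r → Finset (Fin r) := fun i => Finset.univ.filter fun j => R i j ∧ R j i with hL
  have hmemL : ∀ i j, j ∈ L i ↔ R i j ∧ R j i := fun i j => by simp [hL]
  have hUL : ∀ i, ¬ ColorAcc K x c i → U (L i) := by
    intro i hi
    refine ⟨fun k hk _ _ hak => absurd (hacc ((hmemL i k).1 hk).1 hak) hi,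
      fun k hk j hj hkj hjk => hj ?_⟩
    rw [hmemL] at hk ⊢
    exact ⟨hk.1.trans hkj, hjk.trans hk.2⟩
  obtain ⟨i, hi, hLi⟩ : ∃ i, ¬ ColorAcc K x c i ∧ r ≤ (L i).card + 2 := by
    by_contra! hcon
    obtain ⟨X, hX, hmax⟩ := Finset.exists_max_image
      (Finset.univ.filter fun X => accSet K x c ⊆ X ∧ U X ∧ X.card ≤ 2) Finset.card
      ⟨accSet K x c, by simp [hUacc, ha]⟩
    simp only [Finset.mem_filter, Finset.mem_univ, true_and] at hX hmax
    obtain ⟨hAX, hUX, hX2⟩ := hX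
    obtain ⟨i, hi⟩ : ∃ i, i ∉ X := by
      by_contra! hall
      have : X = Finset.univ := Finset.eq_univ_of_forall hall
      rw [this, Finset.card_univ, Fintype.card_fin] at hX2
      omega
    have hia : ¬ ColorAcc K x c i := fun h => hi (hAX (mem_accSet.2 h))
    have hUXL := hUunion X (L i) hUX (hUL i hia)
    have h1 := hUcard _ (hUL i hia)
    have h2 := hcon i hia
    have h3 := hUcard _ hUXL
    have h4 := Finset.card_union_le X (L i)
    have h5 := hmax (X ∪ L i) ⟨hAX.trans Finset.subset_union_left, hUXL, by omega⟩
    have h6 : X.card < (X ∪ L i).card := by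
      apply Finset.card_lt_card
      rw [Finset.ssubset_iff_of_subset Finset.subset_union_left]
      exact ⟨i, Finset.mem_union_right _ ((hmemL i i).2 ⟨.refl, .refl⟩), hi⟩
    omega
  have haL : ∀ j, ColorAcc K x c j → j ∈ (L i)ᶜ := by
    intro j hj
    rw [Finset.mem_compl, hmemL]
    exact fun h => hi (hacc h.1 hj)
  have hcard : ((L i)ᶜ.erase (c x)).card ≤ 1 := by
    rw [Finset.card_erase_of_mem (haL _ .refl), Finset.card_compl, Fintype.card_fin]
    omega
  obtain ⟨W, hW, hWL⟩ : ∃ W, W ≠ c x ∧ (L i)ᶜ.erase (c x) ⊆ {W} := by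
    rcases ((L i)ᶜ.erase (c x)).eq_empty_or_nonempty with h0 | ⟨W, hW⟩
    · have : Nontrivial (Fin r) := Fin.nontrivial_iff_two_le.2 (by omega)
      obtain ⟨W, hW⟩ := exists_ne (c x)
      exact ⟨W, hW, by simp [h0]⟩
    · refine ⟨W, (Finset.mem_erase.1 hW).1, fun j hj => Finset.mem_singleton.2 ?_⟩
      exact Finset.card_le_one.1 hcard j hj W hW
  have hout : ∀ j, j ≠ c x → j ≠ W → R i j ∧ R j i := by
    intro j hj hjW
    rw [← hmemL]
    by_contra hcon
    exact hjW (Finset.mem_singleton.1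
      (hWL (Finset.mem_erase.2 ⟨hj, Finset.mem_compl.2 hcon⟩)))
  refine ⟨W, hW, fun j hj => ?_, fun j k hj hjW hk hkW =>
    (hout j hj hjW).2.trans (hout k hk hkW).1⟩
  by_contra! hcon
  exact hi (hacc (hout j hcon.1 hcon.2).1 hj)

/-- A vertex of the class `W` can be exchanged for one of its solo neighbors such that another
one of its solo neighbors fits into the resulting class. -/
theorem IsExactColoring.exists_class_exchange (hc : IsExactColoring K s c) (hB : BipBound K)
    (hr : 9 ≤ r) (hdeg : ∀ v, (Finset.univ.filter (K.Adj v)).card ≤ r) {W : Fin r}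
    (hW : W ≠ c x)
    (hstrong : ∀ i j, i ≠ c x → i ≠ W → j ≠ c x → j ≠ W →
      Relation.ReflTransGen (ColorArc K x c) i j)
    (hclosed : ∀ p q, ColorArc K x c p q → p ∉ ({c x, W} : Finset (Fin r)) →
      q ∉ ({c x, W} : Finset (Fin r)))
    (hmov : ∀ w u, c w = W → (∀ b, K.Adj w b → c b ≠ c x) → K.Adj w u → c u ≠ c x → c u ≠ W →
      ¬ ∀ b, c b = W → K.Adj b u → b = w) :
    ∃ (c' : V → Fin r) (w u u' : V), IsExactColoring K s c' ∧
      (∀ z, c' z = c x ↔ c z = c x) ∧ c w = W ∧ (∃ b, K.Adj w b ∧ c b = c x) ∧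
      (∀ z, c' z = W ↔ (c z = W ∧ z ≠ w) ∨ z = u) ∧
      c' u' ≠ c x ∧ ColorArc K x c' (c' u') W := by
  have hs : 0 < s := by
    rw [← hc.2 (c x)]
    exact Finset.card_pos.2 ⟨x, by simp⟩
  set F : Finset (Fin r) := {c x, W} with hF
  have hFcard : F.card = 2 := Finset.card_pair hW.symm
  have hT : Fᶜ.card = r - 2 := by rw [Finset.card_compl, Fintype.card_fin, hFcard]
  have hmemF : ∀ i, i ∉ F ↔ i ≠ c x ∧ i ≠ W := fun i => by simp [hF]
  set A := Finset.univ.filter fun v => c v = W with hA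
  set S := Finset.univ.filter fun v => c v ∈ Fᶜ with hS
  have hmemS : ∀ u, u ∈ S ↔ c u ≠ c x ∧ c u ≠ W := fun u => by
    simp only [hS, Finset.mem_filter, Finset.mem_univ, true_and, Finset.mem_compl, hmemF]
  have hScard : S.card = (r - 2) * s := by rw [hS, hc.card_eq, hT]
  have hcover : ∀ u ∈ S, ∃ w ∈ A, K.Adj w u := by
    intro u hu
    rw [hmemS] at hu
    have hux : u ≠ x := by
      rintro rfl
      exact hu.1 rfl
    obtain ⟨w, huw, hw⟩ := exists_adj_of_not_colorArc (K := K) (x := x) (c := c) hu.2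
      (fun h => by simpa [hF] using hclosed _ _ h ((hmemF _).2 hu)) hux rfl
    exact ⟨w, by simp [hA, hw], huw.symm⟩
  have hsum := two_mul_card_le_sum K A S hcover
  obtain ⟨w, hwA, hw⟩ : ∃ w ∈ A, 2 * r - 4 ≤
      (soloSet K A S w).card + (S.filter (K.Adj w)).card := by
    by_contra! hcon
    have := Finset.sum_le_card_nsmul A _ (2 * r - 5) fun w hw => by
      have := hcon w hw
      show (soloSet K A S w).card + (S.filter (K.Adj w)).card ≤ 2 * r - 5
      omega
    rw [hA, hc.2 W, ← hA, smul_eq_mul] at this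
    rw [hScard] at hsum
    have h1 : 2 * ((r - 2) * s) = s * (2 * r - 5) + s := by
      obtain ⟨k, rfl⟩ := Nat.exists_eq_add_of_le hr
      have e1 : 9 + k - 2 = 7 + k := by omega
      have e2 : 2 * (9 + k) - 5 = 13 + 2 * k := by omega
      rw [e1, e2]
      ring
    omega
  have hwW : c w = W := by simpa [hA] using hwA
  set N := S.filter (K.Adj w) with hN
  set Q := soloSet K A S w with hQ
  have hQN : Q ⊆ N := by
    intro u hu
    simp only [hQ, soloSet, Finset.mem_filter] at hu
    simp [hN, hu.1, hu.2.1]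
  have hmemQ : ∀ u ∈ Q, (c u ≠ c x ∧ c u ≠ W) ∧ K.Adj w u ∧
      ∀ b, c b = W → K.Adj b u → b = w := by
    intro u hu
    simp only [hQ, soloSet, Finset.mem_filter, hmemS] at hu
    exact ⟨hu.1, hu.2.1, fun b hb => hu.2.2 b (by simp [hA, hb])⟩
  have hNle : N ⊆ Finset.univ.filter (K.Adj w) := Finset.filter_subset_filter _ (by simp)
  obtain ⟨b₀, hwb₀, hb₀⟩ : ∃ b, K.Adj w b ∧ c b = c x := by
    by_contra! hcon
    have hQ0 : Q = ∅ := by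
      rw [Finset.eq_empty_iff_forall_notMem]
      intro u hu
      obtain ⟨h1, h2, h3⟩ := hmemQ u hu
      exact hmov w u hwW hcon h2 h1.1 h1.2 h3
    have := (Finset.card_le_card hNle).trans (hdeg w)
    rw [hQ0, Finset.card_empty] at hw
    omega
  have hNcard : N.card + 1 ≤ r := by
    refine le_trans ?_ (hdeg w)
    apply Finset.card_lt_card
    rw [Finset.ssubset_iff_of_subset hNle]
    refine ⟨b₀, by simpa using hwb₀, fun h => ?_⟩
    exact ((hmemS b₀).1 (Finset.mem_filter.1 h).1).1 hb₀
  have hQcard := Finset.card_le_card hQN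
  have hQ' := hB.card_le_nonDominating w Q (fun u hu => (hmemQ u hu).2.1) (by omega)
  have hQ'sub : nonDominating K Q ⊆ Q := Finset.filter_subset _ _
  obtain ⟨j, hjF, u, hu, hreach, hfit⟩ : ∃ j ∉ F, ∃ u ∈ nonDominating K Q,
      Relation.ReflTransGen (ColorArc K x c) j (c u) ∧ ∀ b, K.Adj w b → c b = j → b = u := by
    obtain ⟨j, hjT, hj⟩ := exists_color_missing_or_unique c (hQ'sub.trans hQN) Fᶜ (by omega)
    have hjF : j ∉ F := Finset.mem_compl.1 hjT
    have hbN : ∀ b, K.Adj w b → c b = j → b ∈ N := fun b hb hbj => by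
      rw [hN, Finset.mem_filter, hmemS, hbj]
      exact ⟨(hmemF j).1 hjF, hb⟩
    rcases hj with hj | ⟨u, hu, huj, hj⟩
    · obtain ⟨u, hu⟩ := Finset.card_pos.1 (show 0 < (nonDominating K Q).card by omega)
      have h1 := (hmemQ u (hQ'sub hu)).1
      have h2 := (hmemF j).1 hjF
      exact ⟨j, hjF, u, hu, hstrong j (c u) h2.1 h2.2 h1.1 h1.2,
        fun b hb hbj => absurd hbj (hj b (hbN b hb hbj))⟩
    · exact ⟨j, hjF, u, hu, huj ▸ .refl, fun b hb hbj => hj b (hbN b hb hbj) hbj⟩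
  obtain ⟨h1, h2, h3⟩ := hmemQ u (hQ'sub hu)
  obtain ⟨c', hc', hc'W, hc'F⟩ := exists_exchange hc hclosed (v := w) (by simp [hF, hwW]) hjF
    hreach (fun b hb hbw => h3 b (hbw.trans hwW) hb.symm) hfit
  rw [hwW] at hc'W hc'F
  obtain ⟨-, u', hu', huu', hnadj⟩ := Finset.mem_filter.1 hu
  obtain ⟨h1', h2', h3'⟩ := hmemQ u' hu'
  have h0 := hc'F (c x) (by simp [hF]) hW.symm
  refine ⟨c', w, u, u', hc', h0, hwW, ⟨b₀, hwb₀, hb₀⟩, hc'W, fun h => h1'.1 ((h0 u').1 h), ?_, u',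
    ?_, rfl, fun b hb hbW => ?_⟩
  · rw [Ne, hc'W]
    simp [h1'.2, huu']
  · rintro rfl
    exact h1'.1 rfl
  · rcases (hc'W b).1 hbW with ⟨hbW', hbw⟩ | rfl
    · exact hbw (h3' b hbW' hb.symm)
    · exact hnadj hb.symm

/-- If only the color of `x` is accessible, then the solo neighbors of a vertex with many solo
neighbors essentially lie in a single class. -/
theorem IsExactColoring.solo_in_class (hx : ∀ b, ¬ K.Adj x b) (hc : IsExactColoring K s c)
    (hB : BipBound K) (hr : 9 ≤ r) (hdeg : ∀ v, (Finset.univ.filter (K.Adj v)).card ≤ r)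
    (hacc : ∀ c' : V → Fin r, IsExactColoring K s c' → ∀ i, ColorAcc K x c' i → i = c' x)
    {W : Fin r} (hW : W ≠ c x)
    (hstrong : ∀ i j, i ≠ c x → i ≠ W → j ≠ c x → j ≠ W →
      Relation.ReflTransGen (ColorArc K x c) i j) {v : V} (hv : c v = c x) {Q : Finset V}
    (hQ : Q = soloSet K (Finset.univ.filter fun z => c z = c x)
      (Finset.univ.filter fun z => c z ≠ c x) v)
    (hcard : 2 * r - 1 ≤ Q.card +
      ((Finset.univ.filter fun z => c z ≠ c x).filter (K.Adj v)).card) :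
    2 ≤ (nonDominating K Q).card ∧ (∀ u ∈ nonDominating K Q, c u = W) ∧
      ∀ p, p ≠ c x → ¬ ColorArc K x c p W := by
  set F : Finset (Fin r) := {c x, W} with hF
  have hFcard : F.card = 2 := Finset.card_pair hW.symm
  have hT : Fᶜ.card = r - 2 := by rw [Finset.card_compl, Fintype.card_fin, hFcard]
  have hmemF : ∀ i, i ∉ F ↔ i ≠ c x ∧ i ≠ W := fun i => by simp [hF]
  have hclosed : ∀ p q, ColorArc K x c p q → p ∉ ({c x} : Finset (Fin r)) →
      q ∉ ({c x} : Finset (Fin r)) := by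
    intro p q hpq hp hq
    rw [Finset.mem_singleton] at hp hq
    subst hq
    exact hp (hacc c hc p (.single hpq))
  set S := Finset.univ.filter fun z => c z ≠ c x with hS
  set N := S.filter (K.Adj v) with hN
  have hmemQ : ∀ u, u ∈ Q ↔ c u ≠ c x ∧ K.Adj v u ∧ ∀ b, c b = c x → K.Adj b u → b = v := by
    intro u
    simp [hQ, soloSet, hS]
  have hQN : Q ⊆ N := by
    intro u hu
    rw [hmemQ] at hu
    simp [hN, hS, hu.1, hu.2.1]
  have hNcard : N.card ≤ r :=
    (Finset.card_le_card (Finset.filter_subset_filter _ (by simp))).trans (hdeg v)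
  have hQcard := Finset.card_le_card hQN
  have hQ' := hB.card_le_nonDominating v Q (fun u hu => ((hmemQ u).1 hu).2.1) (by omega)
  have hQ'sub : nonDominating K Q ⊆ Q := Finset.filter_subset _ _
  have hvx : x ≠ v := by
    rintro rfl
    obtain ⟨u, hu⟩ := Finset.card_pos.1 (show 0 < Q.card by omega)
    exact hx u ((hmemQ u).1 hu).2.1
  have key : ∀ u ∈ nonDominating K Q, ∀ j, j ≠ c x →
      Relation.ReflTransGen (ColorArc K x c) j (c u) → ¬ ∀ b ∈ N, c b = j → b = u := by
    intro u hu j hj hreach hfit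
    have h1 := (hmemQ u).1 (hQ'sub hu)
    obtain ⟨c', hc', hc'v, -⟩ := exists_exchange hc hclosed (v := v) (by simp [hv])
      (by simpa using hj) hreach (fun b hb hbv => h1.2.2 b (hbv.trans hv) hb.symm)
      (fun b hb hbj => hfit b (by simp [hN, hS, hb, hbj, hj]) hbj)
    rw [hv] at hc'v
    obtain ⟨-, u', hu', huu', hnadj⟩ := Finset.mem_filter.1 hu
    have h1' := (hmemQ u').1 hu'
    have hx' : c' x = c x := (hc'v x).2 (Or.inl ⟨rfl, hvx⟩)
    have hu'x : c' u' ≠ c x := by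
      rw [Ne, hc'v]
      simp [h1'.1, huu']
    refine hu'x (hx' ▸ hacc c' hc' (c' u') (.single ⟨hx' ▸ hu'x, u', ?_, rfl, fun b hb hbx => ?_⟩))
    · rintro rfl
      exact h1'.1 rfl
    · rw [hx'] at hbx
      rcases (hc'v b).1 hbx with ⟨hbx', hbv⟩ | rfl
      · exact hbv (h1'.2.2 b hbx' hb.symm)
      · exact hnadj hb.symm
  obtain ⟨j, hjT, hj⟩ := exists_color_missing_or_unique c (hQ'sub.trans hQN) Fᶜ (by omega)
  have hjF := (hmemF j).1 (Finset.mem_compl.1 hjT)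
  have hmiss : ∀ b ∈ N, c b ≠ j := by
    rcases hj with hj | ⟨u, hu, huj, hj⟩
    · exact hj
    · exact absurd hj (key u hu j hjF.1 (huj ▸ .refl))
  have hnot : ∀ u ∈ nonDominating K Q, ¬ Relation.ReflTransGen (ColorArc K x c) j (c u) :=
    fun u hu h => key u hu j hjF.1 h fun b hb hbj => absurd hbj (hmiss b hb)
  have hclass : ∀ u ∈ nonDominating K Q, c u = W := by
    intro u hu
    by_contra hcon
    exact hnot u hu (hstrong j (c u) hjF.1 hjF.2 ((hmemQ u).1 (hQ'sub hu)).1 hcon)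
  refine ⟨by omega, hclass, fun p hp harc => ?_⟩
  obtain ⟨u, hu⟩ := Finset.card_pos.1 (show 0 < (nonDominating K Q).card by omega)
  refine hnot u hu ?_
  rw [hclass u hu]
  exact (hstrong j p hjF.1 hjF.2 hp harc.1).tail harc

/-- A second accessible color leads to a coloring with three accessible colors. -/
theorem IsExactColoring.eq_of_colorAcc (hx : ∀ b, ¬ K.Adj x b) (hc : IsExactColoring K s c)
    (hB : BipBound K) (hr : 9 ≤ r) (hdeg : ∀ v, (Finset.univ.filter (K.Adj v)).card ≤ r)
    (hacc : ∀ c' : V → Fin r, IsExactColoring K s c' → (accSet K x c').card ≤ 2) {i : Fin r}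
    (hi : ColorAcc K x c i) : i = c x := by
  by_contra hix
  obtain ⟨W, hW, honly, hstrong⟩ := hc.exists_strong hB hr (hacc c hc)
  obtain rfl : i = W := (honly i hi).resolve_left hix
  have hclosed : ∀ p q, ColorArc K x c p q → p ∉ ({c x, i} : Finset (Fin r)) →
      q ∉ ({c x, i} : Finset (Fin r)) := by
    intro p q hpq hp hq
    have hqa : ColorAcc K x c q := by
      rcases Finset.mem_insert.1 hq with rfl | hq
      · exact .refl
      · exact Finset.mem_singleton.1 hq ▸ hi
    have hpa : ColorAcc K x c p := .head hpq hqa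
    exact hp (by simpa using honly p hpa)
  obtain ⟨-, w₀, hw₀x, hw₀, hmov₀⟩ : ColorArc K x c i (c x) := by
    rcases Relation.ReflTransGen.cases_head hi with h | ⟨q, hiq, hq⟩
    · exact absurd h hix
    · rcases honly q hq with rfl | rfl
      · exact hiq
      · exact absurd rfl hiq.1
  obtain ⟨c', w, u, u', hc', hc'x, hwi, ⟨b, hwb, hb⟩, hc'i, hu'x, hu'i⟩ :=
    hc.exists_class_exchange hB hr hdeg hW hstrong hclosed (by
      intro w u hw hwmov hwu hux hui hsolo
      have hwx : w ≠ x := by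
        rintro rfl
        exact hW hw.symm
      have hne : ∀ b, b ≠ w → b ≠ x → c (Equiv.swap w x b) = c b := fun b h1 h2 => by
        rw [Equiv.swap_apply_of_ne_of_ne h1 h2]
      have hnx : ∀ a b, K.Adj a b → b ≠ x := by
        rintro a _ hab rfl
        exact hx a hab.symm
      have hcw : c (Equiv.swap w x w) = c x := by rw [Equiv.swap_apply_left]
      have hcx : c (Equiv.swap w x x) = i := by rw [Equiv.swap_apply_right, hw]
      have hexact := hc.comp_perm (K' := K) (Equiv.swap w x) (by
        intro a b hab
        have hax := hnx b a hab.symm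
        have hbx := hnx a b hab
        by_cases ha : a = w
        · subst ha
          rw [hcw, hne b hab.ne.symm hbx]
          exact (hwmov b hab).symm
        by_cases hb : b = w
        · subst hb
          rw [hcw, hne a ha hax]
          exact hwmov a hab.symm
        rw [hne a ha hax, hne b hb hbx]
        exact hc.1 a b hab)
      have h1 : ColorArc K x (fun z => c (Equiv.swap w x z)) (c x) i := by
        refine ⟨hW.symm, w, hwx, hcw, fun b hwb => ?_⟩
        simp only [hne b hwb.ne.symm (hnx w b hwb)]
        exact hw ▸ (hc.1 w b hwb).symm
      have hux' := hnx w u hwu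
      have h2 : ColorArc K x (fun z => c (Equiv.swap w x z)) (c u) i := by
        refine ⟨hui, u, hux', hne u hwu.ne.symm hux', fun b hub => ?_⟩
        by_cases hbw : b = w
        · subst hbw
          simp only [hcw]
          exact hW.symm
        · simp only [hne b hbw (hnx u b hub)]
          exact fun h => hbw (hsolo b h hub.symm)
      refine absurd (hacc _ hexact) (not_le.2 (card_accSet_gt_two (i := c x) (j := c u) ?_ ?_
        hux.symm ?_ ?_))
      · simpa only [hcx] using hW.symm
      · simpa only [hcx] using hui
      · exact .single (by simpa only [hcx] using h1)
      · exact .single (by simpa only [hcx] using h2))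
  have hx' : c' x = c x := (hc'x x).2 rfl
  have hw₀w : w₀ ≠ w := by
    rintro rfl
    exact hmov₀ b hwb hb
  have harc : ColorArc K x c' i (c' x) := by
    rw [hx']
    refine ⟨hW, w₀, hw₀x, (hc'i w₀).2 (Or.inl ⟨hw₀, hw₀w⟩), fun b hb => ?_⟩
    rw [Ne, hc'x]
    exact hmov₀ b hb
  exact absurd (hacc c' hc') (not_le.2 (card_accSet_gt_two (hx' ▸ hW) (hx' ▸ hu'x)
    hu'i.1.symm (.single harc) (.head hu'i (.single harc))))

/-- Some exact coloring has at least three accessible colors. -/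
theorem IsExactColoring.exists_card_accSet (hx : ∀ b, ¬ K.Adj x b) (hc : IsExactColoring K s c)
    (hB : BipBound K) (hr : 9 ≤ r) (hdeg : ∀ v, (Finset.univ.filter (K.Adj v)).card ≤ r) :
    ∃ c' : V → Fin r, IsExactColoring K s c' ∧ 2 < (accSet K x c').card := by
  by_contra! hacc
  have hacc' : ∀ c' : V → Fin r, IsExactColoring K s c' → ∀ i, ColorAcc K x c' i → i = c' x :=
    fun c' hc' i hi => hc'.eq_of_colorAcc hx hB hr hdeg hacc hi
  obtain ⟨W, hW, -, hstrong⟩ := hc.exists_strong hB hr (hacc c hc)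
  set A := Finset.univ.filter fun z => c z = c x with hA
  set S := Finset.univ.filter fun z => c z ≠ c x with hS
  have hScard : S.card = (r - 1) * s := by
    have h1 := hc.card_eq ({c x}ᶜ)
    rw [Finset.card_compl, Fintype.card_fin, Finset.card_singleton] at h1
    rw [← h1, hS]
    simp
  have hcover : ∀ u ∈ S, ∃ w ∈ A, K.Adj w u := by
    intro u hu
    have hux : c u ≠ c x := by simpa [hS] using hu
    obtain ⟨w, huw, hw⟩ := exists_adj_of_not_colorArc (K := K) (x := x) (c := c) hux
      (fun h => hux (hacc' c hc _ (.single h))) (fun h => hux (h ▸ rfl)) rfl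
    exact ⟨w, by simp [hA, hw], huw.symm⟩
  have hsum := two_mul_card_le_sum K A S hcover
  obtain ⟨v, hvA, hv⟩ : ∃ v ∈ A, 2 * r - 1 ≤
      (soloSet K A S v).card + (S.filter (K.Adj v)).card := by
    by_contra! hcon
    have hxA : x ∈ A := by simp [hA]
    have hx0 : (soloSet K A S x).card + (S.filter (K.Adj x)).card = 0 := by
      simp [soloSet, hx]
    rw [← Finset.add_sum_erase A _ hxA, hx0, zero_add] at hsum
    have := Finset.sum_le_card_nsmul (A.erase x) _ (2 * r - 2) fun w hw => by
      have := hcon w (Finset.mem_of_mem_erase hw)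
      show (soloSet K A S w).card + (S.filter (K.Adj w)).card ≤ 2 * r - 2
      omega
    rw [Finset.card_erase_of_mem hxA, hA, hc.2 (c x), ← hA, smul_eq_mul] at this
    rw [hScard] at hsum
    have hs : 0 < s := by
      rw [← hc.2 (c x)]
      exact Finset.card_pos.2 ⟨x, hxA⟩
    obtain ⟨k, rfl⟩ := Nat.exists_eq_add_of_le hr
    obtain ⟨t, rfl⟩ := Nat.exists_eq_add_of_le hs
    have e1 : 9 + k - 1 = 8 + k := by omega
    have e2 : 2 * (9 + k) - 2 = 16 + 2 * k := by omega
    have e3 : 0 + 1 + t - 1 = t := by omega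
    rw [e2, e3] at this
    rw [e1] at hsum
    nlinarith
  have hvx : c v = c x := by simpa [hA] using hvA
  obtain ⟨h2, hclass, hin⟩ := hc.solo_in_class hx hB hr hdeg hacc' hW hstrong hvx rfl hv
  obtain ⟨c', w, u, u', hc', hc'x, hwW, -, hc'W, hu'x, hu'W⟩ :=
    hc.exists_class_exchange hB hr hdeg hW hstrong (by
      intro p q hpq hp hq
      simp only [Finset.mem_insert, Finset.mem_singleton, not_or] at hp hq
      rcases hq with rfl | rfl
      · exact hp.1 (hacc' c hc p (.single hpq))
      · exact hin p hp.1 hpq) (by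
      intro w u hw hwmov _ _ _ _
      refine hW (hacc' c hc W (.single ⟨hW, w, ?_, hw, hwmov⟩))
      rintro rfl
      exact hW hw.symm)
  have hx' : c' x = c x := (hc'x x).2 rfl
  obtain ⟨W', hW', -, hstrong'⟩ := hc'.exists_strong hB hr (hacc c' hc')
  have hA' : (Finset.univ.filter fun z => c' z = c' x) = A := by
    rw [hA, hx']
    exact Finset.filter_congr fun z _ => hc'x z
  have hS' : (Finset.univ.filter fun z => c' z ≠ c' x) = S := by
    rw [hS, hx']
    exact Finset.filter_congr fun z _ => (hc'x z).not
  obtain ⟨-, hclass', hin'⟩ := hc'.solo_in_class hx hB hr hdeg hacc' hW' hstrong'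
    (v := v) (Q := soloSet K A S v) (by rw [hx', hc'x, hvx]) (by rw [hA', hS'])
    (by rw [hS']; exact hv)
  obtain ⟨y, hy, hyw⟩ := Finset.exists_mem_ne h2 w
  have hWW' : W = W' := by
    rw [← hclass' y hy]
    exact ((hc'W y).2 (Or.inl ⟨hclass y hy, hyw⟩)).symm
  subst hWW'
  exact hin' _ (hx' ▸ hu'x) hu'W

end Core

/-- An exact coloring of `G` without the edges at a vertex of small degree yields an exact
coloring of `G`. -/
theorem IsExactColoring.exists_of_isolate [Fintype V] {G K : SimpleGraph V} {x : V} {s : ℕ}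
    {c : V → Fin r} (hK : ∀ a b, K.Adj a b ↔ G.Adj a b ∧ a ≠ x ∧ b ≠ x) (hB : BipBound G)
    (hr : 9 ≤ r) (hdeg : ∀ v, (Finset.univ.filter (G.Adj v)).card ≤ r)
    (hx5 : (Finset.univ.filter (G.Adj x)).card ≤ 5) (hc : IsExactColoring K s c) :
    ∃ c' : V → Fin r, IsExactColoring G s c' := by
  by_contra! hno
  have hKG : K ≤ G := fun a b h => ((hK a b).1 h).1
  have hxK : ∀ b, ¬ K.Adj x b := fun b h => ((hK x b).1 h).2.1 rfl
  have hnbr : ∀ c' : V → Fin r, IsExactColoring K s c' → ∀ i, ColorAcc K x c' i →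
      ∃ b, G.Adj x b ∧ c' b = i := by
    intro c' hc' i hi
    by_contra! hfree
    obtain ⟨-, hpath⟩ := reflTransGen_restrict (F := ∅) hi (by simp) (by simp)
    obtain ⟨σ, hσ, -⟩ := exists_perm_shift G ∅ c' x i
      (fun a b hab ha hb => hc'.1 a b ((hK a b).2 ⟨hab, ha, hb⟩)) hfree
      (Relation.ReflTransGen.mono (by
        rintro p q ⟨⟨hpq, z, hzx, hzp, hz⟩, h⟩
        exact ⟨⟨hpq, z, hzx, hzp, fun b hb hzb => hz b ((hK z b).2 ⟨hzb, hzx, hb⟩)⟩, h⟩) _ _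
        hpath) (by simp)
    exact hno _ (hc'.comp_perm σ hσ)
  have hBK := hB.mono hKG
  obtain ⟨c', hc', h2⟩ := hc.exists_card_accSet hxK hBK hr fun v =>
    (Finset.card_le_card fun b hb => by
      simp only [Finset.mem_filter, Finset.mem_univ, true_and] at hb ⊢
      exact hKG hb).trans (hdeg v)
  have h5 : (accSet K x c').card ≤ 5 := by
    refine le_trans ?_ ((Finset.card_image_le (f := c')).trans hx5)
    refine Finset.card_le_card fun i hi => ?_
    obtain ⟨b, hb, hbi⟩ := hnbr c' hc' i (mem_accSet.1 hi)
    exact Finset.mem_image.2 ⟨b, by simpa using hb, hbi⟩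
  have := hc'.card_le_two_or_of_union hBK hr (accSet K x c')
    (fun i _ j hj _ h => hj (mem_accSet.2 h))
    (fun i hi j hj _ h => hj (mem_accSet.2 (colorAcc_of_colorArc h (mem_accSet.1 hi))))
  omega

/-- Every nonempty set of vertices contains a vertex with at most `d` neighbors in that set. -/
def IsDegenerate (G : SimpleGraph V) (d : ℕ) : Prop :=
  ∀ S : Finset V, S.Nonempty → ∃ x ∈ S, (S.filter (G.Adj x)).card ≤ d

/-- The subgraph of all edges with both endpoints in `S`, on the same vertex set. -/
def restrictTo (G : SimpleGraph V) (S : Finset V) : SimpleGraph V where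
  Adj a b := G.Adj a b ∧ a ∈ S ∧ b ∈ S
  symm := ⟨fun _ _ h => ⟨h.1.symm, h.2.2, h.2.1⟩⟩
  loopless := ⟨fun _ h => h.1.ne rfl⟩

theorem exists_isExactColoring [Fintype V] {G : SimpleGraph V} {s : ℕ} (hB : BipBound G)
    (hr : 9 ≤ r) (hdeg : ∀ v, (Finset.univ.filter (G.Adj v)).card ≤ r) (hD : IsDegenerate G 5)
    (hV : Fintype.card V = r * s) : ∃ c : V → Fin r, IsExactColoring G s c := by
  suffices h : ∀ S : Finset V, ∃ c : V → Fin r, IsExactColoring (restrictTo G S) s c by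
    obtain ⟨c, hc⟩ := h Finset.univ
    exact ⟨c, fun a b hab => hc.1 a b ⟨hab, by simp, by simp⟩, hc.2⟩
  intro S
  induction hn : S.card generalizing S with
  | zero =>
    rw [Finset.card_eq_zero] at hn
    subst hn
    have e : V ≃ Fin r × Fin s := Fintype.equivOfCardEq (by simp [hV])
    refine ⟨fun v => (e v).1, fun a b hab => absurd hab.2.1 (by simp), fun i => ?_⟩
    have : s = (Finset.univ : Finset (Fin s)).card := by simp
    conv_rhs => rw [this]
    refine Finset.card_bij' (fun v _ => (e v).2) (fun j _ => e.symm (i, j)) (by simp) (by simp)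
      ?_ (by simp)
    intro v hv
    have hv' : (e v).1 = i := by simpa using hv
    rw [← hv', Prod.mk.eta, e.symm_apply_apply]
  | succ n ih =>
    obtain ⟨x, hxS, hx⟩ := hD S (Finset.card_pos.1 (by omega))
    obtain ⟨c, hc⟩ := ih (S.erase x) (by rw [Finset.card_erase_of_mem hxS, hn]; rfl)
    have hle : restrictTo G S ≤ G := fun a b h => h.1
    refine IsExactColoring.exists_of_isolate (x := x) (fun a b => ?_) (hB.mono hle) hr
      (fun v => (Finset.card_le_card fun b hb => ?_).trans (hdeg v))
      ((Finset.card_le_card fun b hb => ?_).trans hx) hc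
    · simp only [restrictTo, Finset.mem_erase]
      tauto
    · simp only [Finset.mem_filter, Finset.mem_univ, true_and] at hb ⊢
      exact hle hb
    · simp only [Finset.mem_filter, Finset.mem_univ, true_and] at hb ⊢
      exact ⟨hb.2.2, hb.1⟩

theorem BipBound.comap {W : Type*} {G : SimpleGraph V} (hB : BipBound G) (f : W ↪ V) :
    BipBound (G.comap f) := by
  intro X Y hXY h3
  have := hB (X.map f) (Y.map f) ((Finset.disjoint_map f).2 hXY) (by simpa using h3)
  rw [Finset.card_map, Finset.card_map] at this
  refine le_trans (Nat.add_le_add_right (Finset.card_le_card_of_injOn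
    (fun e => (f e.1, f e.2)) ?_ ?_) 4) this
  · rintro ⟨a, b⟩ he
    simp only [Finset.mem_coe, SimpleGraph.mem_interedges_iff, SimpleGraph.comap_adj] at he ⊢
    exact ⟨Finset.mem_map_of_mem f he.1, Finset.mem_map_of_mem f he.2.1, he.2.2⟩
  · rintro ⟨a, b⟩ - ⟨a', b'⟩ - h
    simpa using h

theorem IsDegenerate.comap {W : Type*} {G : SimpleGraph V} {d : ℕ} (hD : IsDegenerate G d)
    (f : W ↪ V) : IsDegenerate (G.comap f) d := by
  intro S hS
  obtain ⟨x, hx, hxd⟩ := hD (S.map f) (hS.map)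
  obtain ⟨y, hy, rfl⟩ := Finset.mem_map.1 hx
  refine ⟨y, hy, le_trans ?_ hxd⟩
  rw [← Finset.card_map f]
  refine Finset.card_le_card fun z hz => ?_
  obtain ⟨b, hb, rfl⟩ := Finset.mem_map.1 hz
  rw [Finset.mem_filter] at hb ⊢
  exact ⟨Finset.mem_map_of_mem f hb.1, hb.2⟩

theorem BipBound.sum_top {G : SimpleGraph V} (hB : BipBound G) {p : ℕ} (hp : p ≤ 4) :
    BipBound (G.sum (⊤ : SimpleGraph (Fin p))) := by
  intro X Y hXY h3
  have hcard : ((G.sum (⊤ : SimpleGraph (Fin p))).interedges X Y).card ≤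
      (G.interedges X.toLeft Y.toLeft).card + (X.toRight ×ˢ Y.toRight).card := by
    rw [← Finset.card_disjSum]
    refine Finset.card_le_card_of_injOn (fun e => match e with
      | (.inl a, .inl b) => .inl (a, b)
      | (.inr a, .inr b) => .inr (a, b)
      | (.inl _, .inr b) => .inr (b, b)
      | (.inr a, .inl _) => .inr (a, a)) ?_ ?_
    · rintro ⟨a | a, b | b⟩ he <;>
        simp [SimpleGraph.mem_interedges_iff] at he ⊢ <;> tauto
    · rintro ⟨a | a, b | b⟩ he ⟨a' | a', b' | b'⟩ he' h <;>
        simp [SimpleGraph.mem_interedges_iff] at he he' h ⊢ <;> tauto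
  have hX := X.card_toLeft_add_card_toRight
  have hY := Y.card_toLeft_add_card_toRight
  have hdl : Disjoint X.toLeft Y.toLeft := by
    rw [Finset.disjoint_left] at hXY ⊢
    intro a ha hb
    exact hXY (Finset.mem_toLeft.1 ha) (Finset.mem_toLeft.1 hb)
  have hdr : Disjoint X.toRight Y.toRight := by
    rw [Finset.disjoint_left] at hXY ⊢
    intro a ha hb
    exact hXY (Finset.mem_toRight.1 ha) (Finset.mem_toRight.1 hb)
  have hright : X.toRight.card + Y.toRight.card ≤ 4 := by
    rw [← Finset.card_union_of_disjoint hdr]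
    exact (Finset.card_le_univ _).trans (by simpa using hp)
  have hleft : (G.interedges X.toLeft Y.toLeft).card ≤ X.toLeft.card * Y.toLeft.card := by
    rw [← Finset.card_product]
    exact Finset.card_filter_le _ _
  have hlB := hB _ _ hdl
  rw [Finset.card_product] at hcard
  rw [← hX, ← hY] at h3 ⊢
  generalize X.toLeft.card = a at *
  generalize Y.toLeft.card = b at *
  have h1 : X.toRight.card ≤ 4 := by omega
  have h2 : Y.toRight.card ≤ 4 := by omega
  generalize X.toRight.card = a' at *
  generalize Y.toRight.card = b' at *
  by_cases hab : 3 ≤ a + b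
  · have := hlB hab
    have : a' * b' ≤ 2 * (a' + b') := by nlinarith
    omega
  · have ha : a ≤ 2 := by omega
    have hb : b ≤ 2 := by omega
    interval_cases a <;> interval_cases b <;> interval_cases a' <;> interval_cases b' <;> omega

theorem IsDegenerate.sum_top {G : SimpleGraph V} {d : ℕ} (hD : IsDegenerate G d) {p : ℕ}
    (hp : p ≤ d) : IsDegenerate (G.sum (⊤ : SimpleGraph (Fin p))) d := by
  intro S hS
  rcases S.toRight.eq_empty_or_nonempty with h0 | ⟨i, hi⟩
  · have hl : ∀ y ∈ S, ∃ a, a ∈ S.toLeft ∧ y = .inl a := by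
      rintro (a | a) ha
      · exact ⟨a, by simpa using ha, rfl⟩
      · exact absurd (Finset.mem_toRight.2 ha) (by simp [h0])
    obtain ⟨y, hy⟩ := hS
    obtain ⟨a, ha, -⟩ := hl y hy
    obtain ⟨x, hx, hxd⟩ := hD S.toLeft ⟨a, ha⟩
    refine ⟨.inl x, Finset.mem_toLeft.1 hx, le_trans ?_ hxd⟩
    rw [← Finset.card_map (s := S.toLeft.filter (G.Adj x)) Function.Embedding.inl]
    refine Finset.card_le_card fun y hy => ?_
    rw [Finset.mem_filter] at hy
    obtain ⟨b, hb, rfl⟩ := hl y hy.1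
    exact Finset.mem_map.2 ⟨b, Finset.mem_filter.2 ⟨hb, by simpa using hy.2⟩, rfl⟩
  · refine ⟨.inr i, Finset.mem_toRight.1 hi, ?_⟩
    calc _ ≤ ((Finset.univ : Finset (Fin p)).map (Function.Embedding.inr (α := V))).card := by
          refine Finset.card_le_card ?_
          rintro (y | y) hy
          · simp at hy
          · simp
      _ ≤ d := by simpa using hp

/-- The vertices in `S` can be colored properly with classes of size `s` and `s - 1` when their
number is slightly less than `r * s`. -/
theorem exists_coloring_of_le_four {G : SimpleGraph V} [Fintype V] (hB : BipBound G)
    (hr : 9 ≤ r) (hdeg : ∀ v, (Finset.univ.filter (G.Adj v)).card ≤ r) (hD : IsDegenerate G 5)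
    {S : Finset V} {p s : ℕ} (hp : p ≤ 4) (hS : S.card + p = r * s) :
    ∃ c : V → Fin r, (∀ a ∈ S, ∀ b ∈ S, G.Adj a b → c a ≠ c b) ∧
      ∀ i, (S.filter fun v => c v = i).card ≤ s ∧ s ≤ (S.filter fun v => c v = i).card + 1 ∧
        s ≤ (S.filter fun v => c v = i).card + p := by
  set f : S ↪ V := Function.Embedding.subtype _ with hf
  obtain ⟨c, hc⟩ := exists_isExactColoring (r := r) (s := s) ((hB.comap f).sum_top hp) hr (by
    rintro (a | a)
    · refine le_trans ?_ (hdeg (f a))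
      refine Finset.card_le_card_of_injOn (Sum.elim f fun _ => f a) ?_ ?_
      · rintro (b | b) hb
        · simpa using hb
        · simp at hb
      · rintro (b | b) hb (b' | b') hb' h
        · simpa using h
        all_goals simp at hb hb'
    · refine le_trans (b := 4) ?_ (by omega)
      calc _ ≤ ((Finset.univ : Finset (Fin p)).map (Function.Embedding.inr (α := S))).card := by
            refine Finset.card_le_card ?_
            rintro (y | y) hy
            · simp at hy
            · simp
        _ ≤ 4 := by simpa using hp) ((hD.comap f).sum_top (by omega)) (by simpa using hS)
  refine ⟨fun v => if h : v ∈ S then c (.inl ⟨v, h⟩) else ⟨0, by omega⟩, ?_, fun i => ?_⟩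
  · intro a ha b hb hab
    simp only [ha, hb, dite_true]
    exact hc.1 _ _ (by simpa [hf] using hab)
  have hl : (S.filter fun v => (if h : v ∈ S then c (.inl ⟨v, h⟩) else ⟨0, by omega⟩) = i).card =
      (Finset.univ.filter fun v => c v = i).toLeft.card := by
    symm
    refine Finset.card_bij (fun v _ => v.1) ?_ ?_ ?_
    · intro v hv
      simpa using hv
    · intro v _ w _ h
      exact Subtype.ext h
    · intro v hv
      rw [Finset.mem_filter] at hv
      exact ⟨⟨v, hv.1⟩, by simpa [hv.1] using hv.2, rfl⟩
  have hr1 : (Finset.univ.filter fun v => c v = i).toRight.card ≤ 1 := by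
    refine Finset.card_le_one.2 fun a ha b hb => ?_
    by_contra hab
    have h1 : c (.inr a) = i := by simpa using ha
    have h2 : c (.inr b) = i := by simpa using hb
    exact hc.1 (.inr a) (.inr b) (by simpa using hab) (h1.trans h2.symm)
  have hr2 : (Finset.univ.filter fun v => c v = i).toRight.card ≤ p :=
    (Finset.card_le_univ _).trans (by simp)
  have hsum := (Finset.univ.filter fun v => c v = i).card_toLeft_add_card_toRight
  rw [hc.2 i] at hsum
  rw [hl]
  omega

theorem exists_coloring {G : SimpleGraph V} [Fintype V] (hB : BipBound G)
    (hr : 9 ≤ r) (hdeg : ∀ v, (Finset.univ.filter (G.Adj v)).card ≤ r) (hD : IsDegenerate G 5)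
    (S : Finset V) {p s : ℕ} (hp : p ≤ r) (hS : S.card + p = r * s) :
    ∃ c : V → Fin r, (∀ a ∈ S, ∀ b ∈ S, G.Adj a b → c a ≠ c b) ∧
      ∀ i, (S.filter fun v => c v = i).card ≤ s ∧ s ≤ (S.filter fun v => c v = i).card + 1 := by
  induction hn : S.card using Nat.strong_induction_on generalizing S p with
  | _ n ih =>
  by_cases hp4 : p ≤ 4
  · obtain ⟨c, hc, h⟩ := exists_coloring_of_le_four hB hr hdeg hD hp4 hS
    exact ⟨c, hc, fun i => ⟨(h i).1, (h i).2.1⟩⟩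
  obtain ⟨t, rfl⟩ : ∃ t, s = t + 1 := Nat.exists_eq_succ_of_ne_zero (by
    rintro rfl
    omega)
  rcases hp.eq_or_lt with rfl | hpr
  · obtain ⟨c, hc, h⟩ := exists_coloring_of_le_four (s := t) (S := S) hB hr hdeg hD
      (Nat.zero_le 4) (by rw [mul_add] at hS; omega)
    exact ⟨c, hc, fun i => by have := h i; omega⟩
  have hSne : S.Nonempty := by
    rw [← Finset.card_pos]
    by_contra hcon
    nlinarith
  obtain ⟨x, hxS, hx⟩ := hD S hSne
  have hScard := Finset.card_erase_add_one hxS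
  obtain ⟨c, hc, h⟩ := ih (S.erase x).card (by omega) (S.erase x) (p := p + 1) (by omega)
    (by omega) rfl
  set B := Finset.univ.filter fun i => ((S.erase x).filter fun v => c v = i).card = t with hBdef
  have hBcard : B.card = p + 1 := by
    have h1 : (S.erase x).card = ∑ i, ((S.erase x).filter fun v => c v = i).card :=
      Finset.card_eq_sum_card_fiberwise (by simp)
    have h2 : ∑ i, (((S.erase x).filter fun v => c v = i).card + if i ∈ B then 1 else 0) =
        ∑ _i : Fin r, (t + 1) := by
      refine Finset.sum_congr rfl fun i _ => ?_
      have := h i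
      simp only [hBdef, Finset.mem_filter, Finset.mem_univ, true_and]
      split_ifs <;> omega
    rw [Finset.sum_add_distrib, ← h1, Finset.sum_const, Finset.card_univ, Fintype.card_fin,
      smul_eq_mul, ← hS] at h2
    simp only [Finset.sum_ite_mem, Finset.univ_inter, Finset.sum_const, smul_eq_mul,
      mul_one] at h2
    omega
  obtain ⟨i, hiB, hi⟩ : ∃ i ∈ B, i ∉ (S.filter (G.Adj x)).image c := by
    refine Finset.exists_mem_notMem_of_card_lt_card ?_
    have := Finset.card_image_le (s := S.filter (G.Adj x)) (f := c)
    omega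
  have hfree : ∀ b ∈ S, G.Adj x b → c b ≠ i := fun b hb hxb hbi =>
    hi (Finset.mem_image.2 ⟨b, Finset.mem_filter.2 ⟨hb, hxb⟩, hbi⟩)
  refine ⟨Function.update c x i, fun a ha b hb hab => ?_, fun j => ?_⟩
  · by_cases hax : a = x
    · subst hax
      rw [Function.update_self, Function.update_of_ne hab.ne.symm]
      exact (hfree b hb hab).symm
    by_cases hbx : b = x
    · subst hbx
      rw [Function.update_self, Function.update_of_ne hax]
      exact hfree a ha hab.symm
    rw [Function.update_of_ne hax, Function.update_of_ne hbx]
    exact hc a (Finset.mem_erase.2 ⟨hax, ha⟩) b (Finset.mem_erase.2 ⟨hbx, hb⟩) hab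
  · have hcongr : ((S.erase x).filter fun v => Function.update c x i v = j) =
        (S.erase x).filter fun v => c v = j :=
      Finset.filter_congr fun v hv => by
        rw [Function.update_of_ne (Finset.ne_of_mem_erase hv)]
    have hcount : (S.filter fun v => Function.update c x i v = j).card =
        ((S.erase x).filter fun v => c v = j).card + if i = j then 1 else 0 := by
      rw [← hcongr]
      conv_lhs => rw [← Finset.insert_erase hxS, Finset.filter_insert]
      rw [Function.update_self]
      split_ifs with hij
      · rw [Finset.card_insert_of_notMem (by simp)]
      · rfl
    rw [hcount]
    have hj := h j
    by_cases hij : i = j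
    · subst hij
      simp only [hBdef, Finset.mem_filter, Finset.mem_univ, true_and] at hiB
      simp [hiB]
    · simpa [hij] using hj

theorem PlanarBounds.bipBound [Fintype V] {G : SimpleGraph V} (hG : PlanarBounds G) :
    BipBound G := by
  intro X Y hXY h3
  have h := hG.2 X Y hXY h3
  have hle : (G.interedges X Y).card ≤ edgesBetween G X Y := by
    refine Finset.card_le_card_of_injOn (fun e => s(e.1, e.2)) ?_ ?_
    · rintro ⟨a, b⟩ he
      simp only [Finset.mem_coe, SimpleGraph.mem_interedges_iff] at he
      simp only [Finset.coe_filter, Set.mem_ofPred_eq, SimpleGraph.mem_edgeFinset,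
        SimpleGraph.mem_edgeSet]
      exact ⟨he.2.2, a, he.1, b, he.2.1, rfl⟩
    · rintro ⟨a, b⟩ he ⟨a', b'⟩ he' hs
      simp only [Finset.mem_coe, SimpleGraph.mem_interedges_iff] at he he'
      rcases Sym2.eq_iff.1 hs with ⟨rfl, rfl⟩ | ⟨rfl, rfl⟩
      · rfl
      · exact absurd he'.2.1 (Finset.disjoint_left.1 hXY he.1)
  omega

theorem sum_card_filter_adj_le [Fintype V] (G : SimpleGraph V) (S : Finset V) :
    ∑ v ∈ S, (S.filter (G.Adj v)).card ≤ 2 * edgesWithin G S := by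
  rw [← Finset.card_sigma]
  refine Finset.card_le_mul_card_image_of_maps_to
    (f := fun e : Σ _ : V, V => s(e.1, e.2)) ?_ 2 ?_
  · rintro ⟨a, b⟩ he
    simp only [Finset.mem_sigma, Finset.mem_filter] at he
    simp only [Finset.mem_filter, SimpleGraph.mem_edgeFinset, SimpleGraph.mem_edgeSet,
      Sym2.mem_iff]
    refine ⟨he.2.2, ?_⟩
    rintro v (rfl | rfl)
    · exact he.1
    · exact he.2.1
  · intro e _
    induction e with
    | _ a b =>
    refine le_trans (Finset.card_le_card (t := {⟨a, b⟩, ⟨b, a⟩}) ?_) Finset.card_le_two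
    rintro ⟨a', b'⟩ he
    rcases Sym2.eq_iff.1 (Finset.mem_filter.1 he).2 with ⟨rfl, rfl⟩ | ⟨rfl, rfl⟩ <;> simp

theorem PlanarBounds.isDegenerate [Fintype V] {G : SimpleGraph V} (hG : PlanarBounds G) :
    IsDegenerate G 5 := by
  intro S hS
  by_contra! hcon
  have h1 := Finset.card_nsmul_le_sum S _ 6 hcon
  have h2 := sum_card_filter_adj_le G S
  obtain ⟨x, hx⟩ := hS
  have h3 : 3 ≤ S.card := by
    have := (hcon x hx).trans_le (Finset.card_filter_le _ _)
    omega
  have h4 := hG.1 S h3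
  rw [smul_eq_mul] at h1
  omega

end Proof

/-- **Theorem 1.2 (Yap–Zhang–Nakprasit).** Every graph with maximum degree at most
`r ≥ 9` satisfying the planar edge bounds has an equitable `r`-coloring. -/
theorem planar_equitable_coloring_nine (V : Type*) [Fintype V] (G : SimpleGraph V)
    (r : ℕ) (hr : 9 ≤ r) (hΔ : ∀ v : V, G.degree v ≤ r)
    (hG : PlanarBounds G) :
    ∃ c : V → Fin r, IsEquitableColoring G r c := by
  obtain ⟨c, hc, h⟩ := exists_coloring (s := Fintype.card V / r + 1) hG.bipBound hr
    (fun v => by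
      rw [← SimpleGraph.neighborFinset_eq_filter, SimpleGraph.card_neighborFinset_eq_degree]
      exact hΔ v) hG.isDegenerate Finset.univ (p := r - Fintype.card V % r) (Nat.sub_le _ _) (by
      have h1 := Nat.div_add_mod (Fintype.card V) r
      have h2 := Nat.mod_lt (Fintype.card V) (show 0 < r by omega)
      rw [Finset.card_univ, mul_add, mul_one]
      omega)
  exact ⟨c, fun u v => hc u (Finset.mem_univ u) v (Finset.mem_univ v),
    fun i j => (h i).1.trans (h j).2⟩

end Equitable
end

section
/- Let r ≥ 8 be an integer. Suppose that every finite simple graph H satisfying the planar edge bounds with maximum degree at most r and with |V(H)| divisible by r admits an equitable r-coloring. Then every finite simple graph G satisfying the planar edge bounds with maximum degree at most r admits an equitable r-coloring. (This is Lemma 2.2 of the paper for the planar case.) -/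
open scoped Classical

namespace Equitable

variable {V : Type*}

section EdgeCounts

variable {V W : Type*} [Fintype V] [Fintype W]

lemma edgesWithin_le_choose (G : SimpleGraph V) (S : Finset V) :
    edgesWithin G S ≤ S.card.choose 2 := by
  rw [← Sym2.card_image_offDiag]
  refine Finset.card_le_card fun e he => ?_
  induction e with | _ u v
  simp only [Finset.mem_filter, SimpleGraph.mem_edgeFinset, SimpleGraph.mem_edgeSet,
    Sym2.mem_iff, forall_eq_or_imp, forall_eq] at he
  exact Finset.mem_image.2 ⟨(u, v), Finset.mem_offDiag.2 ⟨he.2.1, he.2.2, he.1.ne⟩, rfl⟩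

lemma edgesBetween_le_card (G : SimpleGraph V) (X Y : Finset V) (T : Finset (Sym2 V))
    (hT : ∀ u ∈ X, ∀ w ∈ Y, G.Adj u w → s(u, w) ∈ T) : edgesBetween G X Y ≤ T.card := by
  refine Finset.card_le_card fun e he => ?_
  obtain ⟨he, u, hu, w, hw, rfl⟩ := Finset.mem_filter.1 he
  exact hT u hu w hw (by simpa using he)

lemma edgesBetween_le_mul (G : SimpleGraph V) (X Y : Finset V) :
    edgesBetween G X Y ≤ X.card * Y.card := by
  rw [← Finset.card_product]
  refine (edgesBetween_le_card G X Y ((X ×ˢ Y).image fun p => s(p.1, p.2)) ?_).trans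
    Finset.card_image_le
  exact fun u hu w hw _ => Finset.mem_image.2 ⟨(u, w), Finset.mem_product.2 ⟨hu, hw⟩, rfl⟩

lemma edgesWithin_univ (G : SimpleGraph V) :
    edgesWithin G Finset.univ = G.edgeFinset.card := by
  simp [edgesWithin]

lemma edgesWithin_comap_le (G : SimpleGraph W) (f : V ↪ W) (S : Finset V) :
    edgesWithin (G.comap f) S ≤ edgesWithin G (S.map f) := by
  refine Finset.card_le_card_of_injOn (Sym2.map f) ?_ (Sym2.map.injective f.injective).injOn
  intro e he
  induction e with | _ u v
  simpa [SimpleGraph.mem_edgeSet] using he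

lemma edgesBetween_comap_le (G : SimpleGraph W) (f : V ↪ W) (X Y : Finset V) :
    edgesBetween (G.comap f) X Y ≤ edgesBetween G (X.map f) (Y.map f) := by
  refine Finset.card_le_card_of_injOn (Sym2.map f) ?_ (Sym2.map.injective f.injective).injOn
  intro e he
  obtain ⟨he, u, hu, w, hw, rfl⟩ := Finset.mem_filter.1 he
  refine Finset.mem_filter.2 ⟨by simpa using he, f u, Finset.mem_map_of_mem f hu, f w,
    Finset.mem_map_of_mem f hw, rfl⟩

lemma edgesWithin_sum_le (G : SimpleGraph V) (H : SimpleGraph W) (S : Finset (V ⊕ W)) :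
    edgesWithin (G ⊕g H) S ≤ edgesWithin G S.toLeft + edgesWithin H S.toRight := by
  unfold edgesWithin
  refine le_trans (Finset.card_le_card (t :=
    (G.edgeFinset.filter fun e => ∀ v ∈ e, v ∈ S.toLeft).image (Sym2.map Sum.inl) ∪
    (H.edgeFinset.filter fun e => ∀ v ∈ e, v ∈ S.toRight).image (Sym2.map Sum.inr)) ?_)
    ((Finset.card_union_le _ _).trans
      (add_le_add Finset.card_image_le Finset.card_image_le))
  intro e he
  induction e with | _ u v
  rw [Finset.mem_union, Finset.mem_image, Finset.mem_image]
  rcases u with u | u <;> rcases v with v | v <;>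
    simp only [Finset.mem_filter, SimpleGraph.mem_edgeFinset, SimpleGraph.mem_edgeSet,
      Sym2.mem_iff, forall_eq_or_imp, forall_eq, SimpleGraph.sum_adj] at he
  · exact Or.inl ⟨s(u, v), by simpa using he, rfl⟩
  · exact he.1.elim
  · exact he.1.elim
  · exact Or.inr ⟨s(u, v), by simpa using he, rfl⟩

lemma edgesBetween_sum_le (G : SimpleGraph V) (H : SimpleGraph W) (X Y : Finset (V ⊕ W)) :
    edgesBetween (G ⊕g H) X Y ≤
      edgesBetween G X.toLeft Y.toLeft + edgesBetween H X.toRight Y.toRight := by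
  refine (edgesBetween_le_card _ X Y
    ((G.edgeFinset.filter fun e => ∃ u ∈ X.toLeft, ∃ w ∈ Y.toLeft, e = s(u, w)).image
      (Sym2.map Sum.inl) ∪
    (H.edgeFinset.filter fun e => ∃ u ∈ X.toRight, ∃ w ∈ Y.toRight, e = s(u, w)).image
      (Sym2.map Sum.inr)) ?_).trans
    ((Finset.card_union_le _ _).trans
      (add_le_add Finset.card_image_le Finset.card_image_le))
  intro u hu v hv huv
  rw [Finset.mem_union, Finset.mem_image, Finset.mem_image]
  rcases u with u | u <;> rcases v with v | v
  · exact Or.inl ⟨s(u, v), Finset.mem_filter.2 ⟨by simpa using huv,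
      u, by simpa using hu, v, by simpa using hv, rfl⟩, rfl⟩
  · simp at huv
  · simp at huv
  · exact Or.inr ⟨s(u, v), Finset.mem_filter.2 ⟨by simpa using huv,
      u, by simpa using hu, v, by simpa using hv, rfl⟩, rfl⟩

end EdgeCounts

namespace PlanarBounds

variable {V W : Type*} [Fintype V] [Fintype W]

lemma of_card_le_four (G : SimpleGraph V) (h : Fintype.card V ≤ 4) : PlanarBounds G := by
  constructor
  · intro S hS
    have hS4 := S.card_le_univ.trans h
    refine (edgesWithin_le_choose G S).trans ?_
    generalize S.card = a at hS hS4
    interval_cases a <;> decide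
  · intro X Y hXY hc
    have h4 : X.card + Y.card ≤ 4 := by
      rw [← Finset.card_union_of_disjoint hXY]
      exact (Finset.card_le_univ _).trans h
    refine (edgesBetween_le_mul G X Y).trans ?_
    generalize X.card = a at hc h4
    generalize Y.card = b at hc h4
    have : a ≤ 4 := by omega
    interval_cases a <;> omega

lemma comap {G : SimpleGraph W} (hG : PlanarBounds G) (f : V ↪ W) :
    PlanarBounds (G.comap f) := by
  constructor
  · intro S hS
    simpa using (edgesWithin_comap_le G f S).trans (hG.1 _ (by simpa using hS))
  · intro X Y hXY hc
    simpa using (edgesBetween_comap_le G f X Y).trans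
      (hG.2 _ _ ((Finset.disjoint_map f).2 hXY) (by simpa using hc))

lemma edgesWithin_le {G : SimpleGraph V} (hG : PlanarBounds G) (S : Finset V)
    (hS : S.Nonempty) : edgesWithin G S ≤ 3 * S.card - 3 := by
  have h1 := hG.1 S
  have h2 := edgesWithin_le_choose G S
  have h0 := hS.card_pos
  generalize S.card = a at *
  rcases le_or_gt 3 a with h | h
  · have := h1 h
    omega
  · interval_cases a <;> simp at h2 <;> omega

lemma edgesBetween_le {G : SimpleGraph V} (hG : PlanarBounds G) (X Y : Finset V)
    (hXY : Disjoint X Y) (h : 1 ≤ X.card + Y.card) :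
    edgesBetween G X Y ≤ 2 * (X.card + Y.card) - 2 := by
  have h1 := hG.2 X Y hXY
  have h2 := edgesBetween_le_mul G X Y
  generalize X.card = a at *
  generalize Y.card = b at *
  rcases le_or_gt 3 (a + b) with h | h
  · have := h1 h
    omega
  · have : a ≤ 2 := by omega
    interval_cases a <;> omega

lemma sum {G : SimpleGraph V} {H : SimpleGraph W} (hG : PlanarBounds G)
    (hH : PlanarBounds H) : PlanarBounds (G ⊕g H) := by
  constructor
  · intro S hS
    have hs := edgesWithin_sum_le G H S
    have hc := S.card_toLeft_add_card_toRight
    have h1 := hG.1 S.toLeft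
    have h2 := hH.1 S.toRight
    have h3 := hG.edgesWithin_le S.toLeft
    have h4 := hH.edgesWithin_le S.toRight
    have h5 := edgesWithin_le_choose G S.toLeft
    have h6 := edgesWithin_le_choose H S.toRight
    rcases S.toLeft.eq_empty_or_nonempty with hl | hl
    · simp only [hl, Finset.card_empty, Nat.choose_zero_succ] at h5 hc hs
      omega
    rcases S.toRight.eq_empty_or_nonempty with hr | hr
    · simp only [hr, Finset.card_empty, Nat.choose_zero_succ] at h6 hc hs
      omega
    have := h3 hl
    have := h4 hr
    have := hl.card_pos
    have := hr.card_pos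
    omega
  · intro X Y hXY hXYc
    have hs := edgesBetween_sum_le G H X Y
    have hcX := X.card_toLeft_add_card_toRight
    have hcY := Y.card_toLeft_add_card_toRight
    have hl : Disjoint X.toLeft Y.toLeft := by
      rw [Finset.disjoint_left] at hXY ⊢
      simpa using fun v => @hXY (Sum.inl v)
    have hr : Disjoint X.toRight Y.toRight := by
      rw [Finset.disjoint_left] at hXY ⊢
      simpa using fun v => @hXY (Sum.inr v)
    have h1 := hG.2 _ _ hl
    have h2 := hH.2 _ _ hr
    have h3 := hG.edgesBetween_le _ _ hl
    have h4 := hH.edgesBetween_le _ _ hr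
    have h5 := edgesBetween_le_mul G X.toLeft Y.toLeft
    have h6 := edgesBetween_le_mul H X.toRight Y.toRight
    rcases Nat.eq_zero_or_pos (X.toLeft.card + Y.toLeft.card) with h0 | h0
    · rw [Nat.add_eq_zero_iff] at h0
      rw [h0.1, zero_mul] at h5
      omega
    rcases Nat.eq_zero_or_pos (X.toRight.card + Y.toRight.card) with h0' | h0'
    · rw [Nat.add_eq_zero_iff] at h0'
      rw [h0'.1, zero_mul] at h6
      omega
    have := h3 h0
    have := h4 h0'
    omega

lemma exists_degree_le_five [Nonempty V] {G : SimpleGraph V} (hG : PlanarBounds G) :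
    ∃ x, G.degree x ≤ 5 := by
  by_contra! h
  have hlt := G.degree_lt_card_verts (Classical.arbitrary V)
  have h6 := h (Classical.arbitrary V)
  have hsum := G.sum_degrees_eq_twice_card_edges
  have hle : Fintype.card V * 6 ≤ ∑ v, G.degree v := by
    simpa using Finset.card_nsmul_le_sum Finset.univ (fun v => G.degree v) 6 fun v _ => h v
  have he := hG.1 Finset.univ (by rw [Finset.card_univ]; omega)
  rw [edgesWithin_univ, Finset.card_univ] at he
  omega

end PlanarBounds

/-- Numbers differing pairwise by at most one: comparing their sum with the number of
indices at which the minimum is attained. -/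
lemma exists_min_of_pairwise_le_succ {r : ℕ} (hr : 0 < r) (a : Fin r → ℕ)
    (ha : ∀ i j, a i ≤ a j + 1) :
    ∃ m, (∀ i, m ≤ a i) ∧ (Finset.univ.filter fun i => a i = m).Nonempty ∧
      ∑ i, a i + (Finset.univ.filter fun i => a i = m).card = r * (m + 1) := by
  have : Nonempty (Fin r) := ⟨⟨0, hr⟩⟩
  obtain ⟨i₀, hi₀⟩ := Finite.exists_min a
  refine ⟨a i₀, hi₀, ⟨i₀, by simp⟩, ?_⟩
  rw [Finset.card_filter, ← Finset.sum_add_distrib]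
  calc _ = ∑ _i : Fin r, (a i₀ + 1) := Finset.sum_congr rfl fun i _ => by
        have := ha i i₀
        have := hi₀ i
        split_ifs <;> omega
    _ = _ := by simp

lemma sum_card_colorClass {V : Type*} [Fintype V] {r : ℕ} (c : V → Fin r) :
    ∑ i, (Finset.univ.filter fun v => c v = i).card = Fintype.card V := by
  rw [← Finset.card_univ]
  exact (Finset.card_eq_sum_card_fiberwise fun v _ => Finset.mem_univ (c v)).symm

lemma IsEquitableColoring.card_colorClass_eq {V : Type*} [Fintype V] {G : SimpleGraph V}
    {r : ℕ} {c : V → Fin r} (hc : IsEquitableColoring G r c) (hdvd : r ∣ Fintype.card V)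
    (i j : Fin r) :
    (Finset.univ.filter fun v => c v = i).card =
      (Finset.univ.filter fun v => c v = j).card := by
  obtain ⟨m, -, hne, hsum⟩ := exists_min_of_pairwise_le_succ i.pos _ hc.2
  rw [sum_card_colorClass] at hsum
  have hL : r ∣ (Finset.univ.filter fun i : Fin r =>
      (Finset.univ.filter fun v => c v = i).card = m).card :=
    (Nat.dvd_add_right hdvd).1 (hsum ▸ dvd_mul_right _ _)
  have huniv := (Finset.card_eq_iff_eq_univ _).1 (le_antisymm (Finset.card_le_univ _)
    ((Fintype.card_fin r).trans_le (Nat.le_of_dvd hne.card_pos hL)))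
  have hm := Finset.filter_eq_self.1 huniv
  rw [hm i (Finset.mem_univ _), hm j (Finset.mem_univ _)]

/-- If the disjoint union of `G` and a complete graph has an equitable coloring and order
divisible by the number of colors, then the coloring restricts to an equitable one of `G`. -/
lemma IsEquitableColoring.of_sum_top {V W : Type*} [Fintype V] [Fintype W]
    {G : SimpleGraph V} {r : ℕ} {c : V ⊕ W → Fin r}
    (hc : IsEquitableColoring (G ⊕g (⊤ : SimpleGraph W)) r c)
    (hdvd : r ∣ Fintype.card (V ⊕ W)) :
    IsEquitableColoring G r (c ∘ Sum.inl) := by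
  refine ⟨fun u v huv => hc.1 _ _ (by simpa using huv), fun i j => ?_⟩
  have hsplit : ∀ k, (Finset.univ.filter fun v => c v = k).card =
      (Finset.univ.filter fun v => c (Sum.inl v) = k).card +
        (Finset.univ.filter fun w => c (Sum.inr w) = k).card := fun k => by
    simp only [Finset.card_filter, Fintype.sum_sum_type]
  have hone : ∀ k, (Finset.univ.filter fun w => c (Sum.inr w) = k).card ≤ 1 := fun k => by
    refine Finset.card_le_one.2 fun u hu w hw => ?_
    by_contra hne
    exact hc.1 (Sum.inr u) (Sum.inr w) (by simpa using hne)
      ((Finset.mem_filter.1 hu).2.trans (Finset.mem_filter.1 hw).2.symm)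
  have := hc.card_colorClass_eq hdvd i j
  have := hsplit i
  have := hsplit j
  have := hone i
  have := hone j
  simp only [Function.comp_apply]
  omega

/-- A color class of minimum size without neighbors of `x` can receive the vertex `x`. -/
lemma IsEquitableColoring.exists_extend {V : Type*} [Fintype V] {G : SimpleGraph V} {x : V}
    {r : ℕ} {c : {v // v ≠ x} → Fin r}
    (hc : IsEquitableColoring (G.comap (Function.Embedding.subtype (· ≠ x))) r c) (i : Fin r)
    (hi : ∀ v, G.Adj x v.1 → c v ≠ i)
    (hmin : ∀ j, (Finset.univ.filter fun v => c v = i).card ≤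
      (Finset.univ.filter fun v => c v = j).card) :
    ∃ c' : V → Fin r, IsEquitableColoring G r c' := by
  let c' : V → Fin r := fun v => if h : v = x then i else c ⟨v, h⟩
  have hx : c' x = i := dif_pos rfl
  have hne : ∀ v (h : v ≠ x), c' v = c ⟨v, h⟩ := fun v h => dif_neg h
  have hcard : ∀ k, (Finset.univ.filter fun v => c' v = k).card =
      (if i = k then 1 else 0) + (Finset.univ.filter fun v => c v = k).card := fun k => by
    simp only [Finset.card_filter]
    rw [Fintype.sum_eq_add_sum_subtype_ne _ x, hx]
    congr 1
    exact Finset.sum_congr rfl fun v _ => by rw [hne v.1 v.2]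
  refine ⟨c', fun u v huv => ?_, fun j k => ?_⟩
  · by_cases hu : u = x
    · subst hu
      rw [hx, hne v huv.ne']
      exact (hi ⟨v, huv.ne'⟩ huv).symm
    · by_cases hv : v = x
      · subst hv
        rw [hx, hne u hu]
        exact hi ⟨u, hu⟩ huv.symm
      · rw [hne u hu, hne v hv]
        exact hc.1 _ _ huv
  · rw [hcard, hcard]
    have h1 := hc.2 j k
    have h2 := hmin k
    split_ifs with hj hk hk
    · omega
    · subst hj
      omega
    · omega
    · omega

lemma degree_comap_le {V W : Type*} [Fintype V] [Fintype W] (G : SimpleGraph W) (f : V ↪ W)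
    (v : V) : (G.comap f).degree v ≤ G.degree (f v) := by
  rw [← SimpleGraph.card_neighborFinset_eq_degree, ← SimpleGraph.card_neighborFinset_eq_degree]
  exact Finset.card_le_card_of_injOn f (fun u hu => by simpa using hu) f.injective.injOn

lemma degree_sum_le {V W : Type*} [Fintype V] [Fintype W] {G : SimpleGraph V}
    {H : SimpleGraph W} {r : ℕ} (hG : ∀ v, G.degree v ≤ r) (hW : Fintype.card W ≤ r)
    (x : V ⊕ W) [Fintype ((G ⊕g H).neighborSet x)] : (G ⊕g H).degree x ≤ r := by
  rcases x with v | w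
  · refine le_trans ?_ (hG v)
    rw [← SimpleGraph.card_neighborFinset_eq_degree, ← SimpleGraph.card_neighborFinset_eq_degree]
    refine (Finset.card_le_card (t := (G.neighborFinset v).map Function.Embedding.inl)
      fun y hy => ?_).trans_eq (Finset.card_map _)
    rcases y with y | y <;> simp_all
  · refine le_trans ?_ ((H.degree_lt_card_verts w).le.trans hW)
    rw [← SimpleGraph.card_neighborFinset_eq_degree, ← SimpleGraph.card_neighborFinset_eq_degree]
    refine (Finset.card_le_card (t := (H.neighborFinset w).map Function.Embedding.inr)
      fun y hy => ?_).trans_eq (Finset.card_map _)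
    rcases y with y | y <;> simp_all

/-- **Lemma 2.2 (planar case).** If every graph satisfying the planar edge bounds with
maximum degree at most `r ≥ 8` and with number of vertices divisible by `r` has an
equitable `r`-coloring, then so does every graph satisfying the planar edge bounds
with maximum degree at most `r`. -/
theorem planar_divisible_reduction (r : ℕ) (hr : 8 ≤ r)
    (hdiv : ∀ (W : Type) [Fintype W] (H : SimpleGraph W),
      PlanarBounds H → (∀ w : W, H.degree w ≤ r) → r ∣ Fintype.card W →
      ∃ c : W → Fin r, IsEquitableColoring H r c)
    (V : Type) [Fintype V] (G : SimpleGraph V)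
    (hG : PlanarBounds G) (hΔ : ∀ v : V, G.degree v ≤ r) :
    ∃ c : V → Fin r, IsEquitableColoring G r c := by
  induction hn : Fintype.card V using Nat.strong_induction_on generalizing V with
  | _ n ih =>
  subst hn
  rcases isEmpty_or_nonempty V with hV | hV
  · exact ⟨isEmptyElim, fun u => isEmptyElim u, fun i j => by simp⟩
  obtain ⟨x, hx⟩ := hG.exists_degree_le_five
  have hcard : Fintype.card {v // v ≠ x} + 1 = Fintype.card V := by
    have := Fintype.card_pos (α := V)
    rw [Fintype.card_subtype_compl, Fintype.card_subtype_eq]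
    omega
  obtain ⟨c, hc⟩ := ih (Fintype.card {v // v ≠ x}) (by omega) {v // v ≠ x}
    (G.comap (Function.Embedding.subtype (· ≠ x))) (hG.comap _)
    (fun v => (degree_comap_le G _ v).trans (hΔ _)) rfl
  obtain ⟨m, hm, hne, hsum⟩ := exists_min_of_pairwise_le_succ (by omega) _ hc.2
  rw [sum_card_colorClass] at hsum
  set L := Finset.univ.filter fun i : Fin r =>
    (Finset.univ.filter fun v => c v = i).card = m
  rcases le_or_gt L.card 5 with hL | hL
  · have hpos := hne.card_pos
    have hdvd : r ∣ Fintype.card (V ⊕ Fin (L.card - 1)) := by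
      refine ⟨m + 1, ?_⟩
      rw [Fintype.card_sum, Fintype.card_fin]
      omega
    obtain ⟨c', hc'⟩ := hdiv (V ⊕ Fin (L.card - 1)) (G ⊕g ⊤)
      (hG.sum (PlanarBounds.of_card_le_four _ (by rw [Fintype.card_fin]; omega)))
      (fun x => by
        convert degree_sum_le hΔ (by rw [Fintype.card_fin]; omega) x) hdvd
    exact ⟨_, hc'.of_sum_top hdvd⟩
  · let N : Finset (Fin r) :=
      (Finset.univ.filter fun v : {v // v ≠ x} => G.Adj x v.1).image c
    have hN : N.card ≤ 5 := by
      refine Finset.card_image_le.trans (le_trans ?_ hx)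
      rw [← SimpleGraph.card_neighborFinset_eq_degree]
      exact Finset.card_le_card_of_injOn Subtype.val (fun u hu => by simpa using hu)
        Subtype.val_injective.injOn
    obtain ⟨i, hiL, hiN⟩ := Finset.exists_mem_notMem_of_card_lt_card (hN.trans_lt hL)
    refine hc.exists_extend i (fun v hv hvi => hiN ?_) fun j => ?_
    · exact Finset.mem_image.2 ⟨v, by simpa using hv, hvi⟩
    · exact (Finset.mem_filter.1 hiL).2.trans_le (hm j)

end Equitable
end

section
/- Setup: let s ≥ 1 be an integer, let G be a finite simple graph on 8s vertices satisfying the planar bipartite edge bound, let x be a vertex of G, and let V_1, …, V_8 be an almost equitable coloring of G − x with small class V_1 and auxiliary digraph H, with at most 4 accessible classes. Then either H has a strong component containing at least 5 classes, or the strong components of H have sizes exactly 3, 3 and 2. (This is Claim 4.2(ii) of the paper.) -/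
open scoped Classical

namespace Equitable

variable {V : Type*}

lemma mem_strongComp {G : SimpleGraph V} {r : ℕ} {P : Fin r → Finset V} {i j : Fin r} :
    j ∈ strongComp G P i ↔
      Relation.ReflTransGen (Arc G P) i j ∧ Relation.ReflTransGen (Arc G P) j i := by
  simp [strongComp]

lemma self_mem_strongComp (G : SimpleGraph V) {r : ℕ} (P : Fin r → Finset V) (i : Fin r) :
    i ∈ strongComp G P i :=
  mem_strongComp.2 ⟨.refl, .refl⟩

lemma strongComp_eq_of_mem {G : SimpleGraph V} {r : ℕ} {P : Fin r → Finset V} {i j : Fin r}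
    (h : j ∈ strongComp G P i) : strongComp G P j = strongComp G P i := by
  obtain ⟨hij, hji⟩ := mem_strongComp.1 h
  ext k
  simp only [mem_strongComp]
  exact ⟨fun ⟨h₁, h₂⟩ => ⟨hij.trans h₁, h₂.trans hji⟩,
    fun ⟨h₁, h₂⟩ => ⟨hji.trans h₁, h₂.trans hij⟩⟩

/-- If no vertex of `P i` is movable to `P j`, there are at least `|P i|` edges between them. -/
lemma card_le_card_interedges_of_not_arc {G : SimpleGraph V} {r : ℕ} {P : Fin r → Finset V}
    {i j : Fin r} (hij : i ≠ j) (h : ¬ Arc G P i j) :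
    (P i).card ≤ (G.interedges (P i) (P j)).card := by
  have h' : ∀ v ∈ P i, ∃ u ∈ P j, G.Adj v u := by
    by_contra! hc
    exact h ⟨hij, hc⟩
  refine (Finset.card_le_card fun v hv => ?_).trans
    (Finset.card_image_le (s := G.interedges (P i) (P j)) (f := Prod.fst))
  obtain ⟨u, hu, huv⟩ := h' v hv
  exact Finset.mem_image.2 ⟨(v, u), G.mem_interedges_iff.2 ⟨hv, hu, huv⟩, rfl⟩

lemma card_interedges_le_edgesBetween [Fintype V] (G : SimpleGraph V) {X Y : Finset V}
    (hXY : Disjoint X Y) : (G.interedges X Y).card ≤ edgesBetween G X Y := by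
  refine Finset.card_le_card_of_injOn (fun p => s(p.1, p.2)) ?_ ?_
  · rintro ⟨u, w⟩ h
    obtain ⟨hu, hw, huw⟩ := G.mem_interedges_iff.1 h
    simp only [Finset.coe_filter, Set.mem_ofPred_eq, SimpleGraph.mem_edgeFinset,
      SimpleGraph.mem_edgeSet]
    exact ⟨huw, u, hu, w, hw, rfl⟩
  · rintro ⟨u, w⟩ h ⟨u', w'⟩ h' heq
    obtain ⟨hu, hw, -⟩ := G.mem_interedges_iff.1 h
    obtain ⟨hu', hw', -⟩ := G.mem_interedges_iff.1 h'
    rcases Sym2.eq_iff.1 heq with ⟨rfl, rfl⟩ | ⟨rfl, rfl⟩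
    · rfl
    · exact (Finset.disjoint_left.1 hXY hu hw').elim

lemma sum_card_interedges_le [Fintype V] (G : SimpleGraph V) {r : ℕ} {P : Fin r → Finset V}
    (hP : ∀ i j, i ≠ j → Disjoint (P i) (P j)) (S T : Finset (Fin r)) :
    ∑ i ∈ S, ∑ j ∈ T, (G.interedges (P i) (P j)).card ≤
      (G.interedges (S.biUnion P) (T.biUnion P)).card := by
  rw [G.interedges_biUnion, Finset.card_biUnion, Finset.sum_product]
  rintro ⟨i, j⟩ _ ⟨i', j'⟩ _ hne
  refine Finset.disjoint_left.2 fun p hp hp' => hne ?_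
  obtain ⟨hi, hj, -⟩ := G.mem_interedges_iff.1 hp
  obtain ⟨hi', hj', -⟩ := G.mem_interedges_iff.1 hp'
  refine Prod.ext ?_ ?_ <;> by_contra h
  · exact Finset.disjoint_left.1 (hP i i' h) hi hi'
  · exact Finset.disjoint_left.1 (hP j j' h) hj hj'

lemma sum_card_classes {s : ℕ} {P : Fin 8 → Finset V}
    (h0 : (P 0).card = s - 1) (hne : ∀ i, i ≠ 0 → (P i).card = s) (hs : 1 ≤ s) :
    ∑ i, (P i).card + 1 = 8 * s := by
  rw [Fin.sum_univ_succ, h0, Finset.sum_congr rfl fun i _ => hne i.succ (Fin.succ_ne_zero i)]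
  simp
  omega

/-- Four classes cannot be separated from the other four in such a way that between any
two classes on different sides some arc is missing. -/
lemma card_ne_four_of_not_arc [Fintype V] {G : SimpleGraph V} {x : V} {s : ℕ} (hs : 1 ≤ s)
    (hbip : PlanarBipBound G) {P : Fin 8 → Finset V} (hP : AEColoring G x s P)
    {S : Finset (Fin 8)} (hS : ∀ i ∈ S, ∀ j ∉ S, ¬ Arc G P i j ∨ ¬ Arc G P j i) :
    S.card ≠ 4 := by
  intro hS4
  obtain ⟨hdisj, -, -, h0, hne⟩ := hP
  have hSc : Sᶜ.card = 4 := by simp [Finset.card_compl, hS4]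
  have hXY : Disjoint (S.biUnion P) (Sᶜ.biUnion P) := by
    simp only [Finset.disjoint_biUnion_left, Finset.disjoint_biUnion_right]
    exact fun i hi j hj => hdisj _ _ fun h => by simp_all
  have hcard : (S.biUnion P).card + (Sᶜ.biUnion P).card + 1 = 8 * s := by
    rw [Finset.card_biUnion fun i _ j _ h => hdisj i j h,
      Finset.card_biUnion fun i _ j _ h => hdisj i j h, Finset.sum_add_sum_compl,
      sum_card_classes h0 hne hs]
  have hpair : ∀ i ∈ S, ∀ j ∈ Sᶜ,
      s ≤ (G.interedges (P i) (P j)).card +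
        ((if i = 0 then 1 else 0) + if j = 0 then 1 else 0) := by
    intro i hi j hj
    have hij : i ≠ j := fun h => Finset.mem_compl.1 hj (h ▸ hi)
    have hsize : ∀ k, s ≤ (P k).card + if k = 0 then 1 else 0 := by
      intro k
      split_ifs with hk
      · subst hk; omega
      · exact (hne k hk).ge
    rcases hS i hi j (Finset.mem_compl.1 hj) with h | h
    · have := card_le_card_interedges_of_not_arc hij h
      have := hsize i
      omega
    · have := card_le_card_interedges_of_not_arc hij.symm h
      have := hsize j
      have : (G.interedges (P j) (P i)).card = (G.interedges (P i) (P j)).card :=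
        have := G.symm
        Rel.card_interedges_comm _ _
      omega
  have hsum : 16 * s ≤ ∑ i ∈ S, ∑ j ∈ Sᶜ, (G.interedges (P i) (P j)).card + 4 := by
    have h := Finset.sum_le_sum fun i hi => Finset.sum_le_sum (hpair i hi)
    simp only [Finset.sum_add_distrib, Finset.sum_const, hS4, hSc, Finset.sum_ite_eq',
      smul_eq_mul, Finset.mem_compl, ← Finset.mul_sum] at h
    split_ifs at h <;> omega
  have h₁ := sum_card_interedges_le G hdisj S Sᶜ
  have h₂ := card_interedges_le_edgesBetween G hXY
  have h₃ := hbip _ _ hXY (by omega)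
  omega

/-- A partition of eight points into blocks `C i` of size at most `4`, no union of which has
size `4`, has blocks of sizes `3`, `3` and `2`. -/
lemma exists_blocks_three_three_two {C : Fin 8 → Finset (Fin 8)} (hself : ∀ i, i ∈ C i)
    (heq : ∀ i, ∀ j ∈ C i, C j = C i) (hle : ∀ i, (C i).card ≤ 4)
    (h4 : ∀ S : Finset (Fin 8), (∀ i ∈ S, C i ⊆ S) → S.card ≠ 4) :
    ∃ i₁ i₂ i₃ : Fin 8, (C i₁).card = 3 ∧ (C i₂).card = 3 ∧ (C i₃).card = 2 ∧
      Disjoint (C i₁) (C i₂) ∧ Disjoint (C i₁) (C i₃) ∧ Disjoint (C i₂) (C i₃) ∧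
      C i₁ ∪ C i₂ ∪ C i₃ = Finset.univ := by
  have hC : ∀ a, ∀ i ∈ C a, C i ⊆ C a := fun a i hi => (heq a i hi).subset
  have hU : ∀ S T : Finset (Fin 8), (∀ i ∈ S, C i ⊆ S) → (∀ i ∈ T, C i ⊆ T) →
      ∀ i ∈ S ∪ T, C i ⊆ S ∪ T := by
    intro S T hS hT i hi
    rcases Finset.mem_union.1 hi with h | h
    · exact (hS i h).trans Finset.subset_union_left
    · exact (hT i h).trans Finset.subset_union_right
  have hD : ∀ S : Finset (Fin 8), (∀ i ∈ S, C i ⊆ S) → ∀ a ∉ S, Disjoint S (C a) := by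
    intro S hS a ha
    refine Finset.disjoint_left.2 fun j hj hja => ha (hS j hj ?_)
    rw [heq a j hja]
    exact hself a
  have hle3 : ∀ i, (C i).card ≤ 3 := fun i => by
    have := hle i
    have := h4 _ (hC i)
    omega
  -- a largest union of blocks with at most `4` elements
  obtain ⟨S, hSmem, hSmax⟩ := Finset.exists_max_image
    (Finset.univ.filter fun S : Finset (Fin 8) => (∀ i ∈ S, C i ⊆ S) ∧ S.card ≤ 4)
    Finset.card ⟨∅, by simp⟩
  obtain ⟨hS, hScard⟩ := (Finset.mem_filter.1 hSmem).2
  have hS3 := h4 S hS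
  have hout : ∀ a ∉ S, 5 ≤ S.card + (C a).card := by
    intro a ha
    by_contra! hlt
    have hcard := Finset.card_union_of_disjoint (hD S hS a ha)
    have := hSmax (S ∪ C a)
      (Finset.mem_filter.2 ⟨Finset.mem_univ _, hU S _ hS (hC a), by omega⟩)
    have := Finset.card_pos.2 ⟨a, hself a⟩
    omega
  have hex : ∀ T : Finset (Fin 8), T.card < 8 → ∃ a, a ∉ T := by
    intro T hT
    by_contra! h
    rw [Finset.eq_univ_of_forall h] at hT
    simp at hT
  obtain ⟨a, ha⟩ := hex S (by omega)
  have hSa := hU S _ hS (hC a)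
  have hSa_card := Finset.card_union_of_disjoint (hD S hS a ha)
  have ha3 := hle3 a
  have ha5 := hout a ha
  obtain ⟨b, hb⟩ := hex (S ∪ C a) (by omega)
  have hSab := hU _ _ hSa (hC b)
  have hSab_card := Finset.card_union_of_disjoint (hD _ hSa b hb)
  have hbS : b ∉ S := fun h => hb (Finset.mem_union_left _ h)
  have hba : b ∉ C a := fun h => hb (Finset.mem_union_right _ h)
  have hb3 := hle3 b
  have hb5 := hout b hbS
  have huniv : S ∪ C a ∪ C b = Finset.univ := by
    refine Finset.eq_univ_of_forall fun d => ?_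
    by_contra hd
    have hcard := Finset.card_union_of_disjoint (hD _ hSab d hd)
    have := hout d fun h => hd (Finset.mem_union_left _ (Finset.mem_union_left _ h))
    have := Finset.card_le_univ (S ∪ C a ∪ C b ∪ C d)
    simp only [Fintype.card_fin] at this
    omega
  have htotal : S.card + (C a).card + (C b).card = 8 := by
    rw [← hSa_card, ← hSab_card, huniv]
    simp
  obtain ⟨c, hc⟩ : S.Nonempty := Finset.card_pos.1 (by omega)
  have hac : a ∉ C c := fun h => ha (hS c hc h)
  have hbc : b ∉ C c := fun h => hbS (hS c hc h)
  have hca := hD _ (hC c) a hac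
  have hcb := hD _ (hC c) b hbc
  have hab := hD _ (hC a) b hba
  have hSeq : C c = S := by
    refine Finset.eq_of_subset_of_card_le (hS c hc) ?_
    have h₁ := h4 _ (hU _ _ (hC c) (hC a))
    have h₂ := h4 _ (hU _ _ (hC c) (hC b))
    rw [Finset.card_union_of_disjoint hca] at h₁
    rw [Finset.card_union_of_disjoint hcb] at h₂
    have := Finset.card_pos.2 ⟨c, hself c⟩
    omega
  rw [← hSeq] at huniv htotal
  have hc3 := hle3 c
  rcases (by omega : (C c).card = 2 ∧ (C a).card = 3 ∧ (C b).card = 3 ∨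
      (C c).card = 3 ∧ (C a).card = 2 ∧ (C b).card = 3 ∨
      (C c).card = 3 ∧ (C a).card = 3 ∧ (C b).card = 2)
    with ⟨h₁, h₂, h₃⟩ | ⟨h₁, h₂, h₃⟩ | ⟨h₁, h₂, h₃⟩
  · refine ⟨a, b, c, h₂, h₃, h₁, hab, hca.symm, hcb.symm, ?_⟩
    rw [← huniv, Finset.union_comm, Finset.union_assoc]
  · refine ⟨c, b, a, h₁, h₃, h₂, hcb, hca, hab.symm, ?_⟩
    rw [← huniv, Finset.union_right_comm]
  · exact ⟨c, a, b, h₁, h₂, h₃, hca, hcb, hab, huniv⟩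

/-- **Claim 4.2(ii).** For a graph on `8s` vertices satisfying the planar bipartite edge
bound: if an almost equitable coloring of `G − x` has at most `4` accessible classes,
then the auxiliary digraph either has a strong component with at least `5` classes, or
its strong components have sizes exactly `3`, `3` and `2`. -/
theorem strong_component_sizes (V : Type*) [Fintype V] (G : SimpleGraph V)
    (x : V) (s : ℕ) (hs : 1 ≤ s) (hcard : Fintype.card V = 8 * s)
    (hbip : PlanarBipBound G)
    (P : Fin 8 → Finset V) (hP : AEColoring G x s P)
    (hA : accCount G P ≤ 4) :
    (∃ i : Fin 8, 5 ≤ (strongComp G P i).card) ∨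
    (∃ i₁ i₂ i₃ : Fin 8,
      (strongComp G P i₁).card = 3 ∧ (strongComp G P i₂).card = 3 ∧
      (strongComp G P i₃).card = 2 ∧
      Disjoint (strongComp G P i₁) (strongComp G P i₂) ∧
      Disjoint (strongComp G P i₁) (strongComp G P i₃) ∧
      Disjoint (strongComp G P i₂) (strongComp G P i₃) ∧
      strongComp G P i₁ ∪ strongComp G P i₂ ∪ strongComp G P i₃ = Finset.univ) := by
  by_cases hbig : ∃ i : Fin 8, 5 ≤ (strongComp G P i).card
  · exact Or.inl hbig
  push Not at hbig
  refine Or.inr (exists_blocks_three_three_two (self_mem_strongComp G P)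
    (fun _ _ => strongComp_eq_of_mem) (fun i => Nat.le_of_lt_succ (hbig i)) fun S hS =>
      card_ne_four_of_not_arc hs hbip hP fun i hi j hj => ?_)
  by_contra! h
  exact hj (hS i hi (mem_strongComp.2 ⟨.single h.1, .single h.2⟩))

end Equitable
end

section
/- Setup: let s ≥ 1 be an integer, let G be a finite simple graph on 8s vertices satisfying the planar bipartite edge bound, and let x be a vertex of G. Suppose some almost equitable coloring of G − x has exactly 5 accessible classes, and no almost equitable coloring of G − x has more than 5 accessible classes. Then there exists an almost equitable coloring of G − x with exactly 5 accessible classes that is nice: in its auxiliary digraph, every accessible class other than the small class blocks at most one accessible class. (This is Lemma 4.4 of the paper.) -/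
open scoped Classical

namespace Equitable

variable {V : Type*}

/-- A nice almost equitable coloring of `G - x`: it has exactly five accessible classes, and
every accessible class other than the small one blocks at most one accessible class. -/
def IsNiceColoring [Fintype V] (G : SimpleGraph V) (x : V) (s : ℕ)
    (P : Fin 8 → Finset V) : Prop :=
  AEColoring G x s P ∧ accCount G P = 5 ∧
    ∀ i : Fin 8, Accessible G P i → i ≠ 0 →
      (Finset.univ.filter fun j : Fin 8 => Accessible G P j ∧ Blocks G P i j).card ≤ 1

/-! ### Counting edges between classes -/

/-- The number of adjacent pairs in `X × Y`. -/
noncomputable def adjCount (G : SimpleGraph V) (X Y : Finset V) : ℕ :=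
  ∑ u ∈ X, ∑ w ∈ Y, if G.Adj u w then 1 else 0

theorem adjCount_comm (G : SimpleGraph V) (X Y : Finset V) :
    adjCount G X Y = adjCount G Y X := by
  unfold adjCount
  rw [Finset.sum_comm]
  simp only [G.adj_comm]

theorem adjCount_le_edgesBetween [Fintype V] (G : SimpleGraph V) {X Y : Finset V}
    (hXY : Disjoint X Y) : adjCount G X Y ≤ edgesBetween G X Y := by
  have hcount : adjCount G X Y = ((X ×ˢ Y).filter fun p => G.Adj p.1 p.2).card := by
    rw [Finset.card_filter, Finset.sum_product]
    rfl
  rw [hcount]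
  refine Finset.card_le_card_of_injOn (fun p => s(p.1, p.2)) ?_ ?_
  · rintro ⟨u, w⟩ h
    simp only [Finset.coe_filter, Finset.mem_product, Set.mem_ofPred_eq] at h
    simp only [Finset.coe_filter, Set.mem_ofPred_eq, SimpleGraph.mem_edgeFinset,
      SimpleGraph.mem_edgeSet]
    exact ⟨h.2, u, h.1.1, w, h.1.2, rfl⟩
  · rintro ⟨u, w⟩ h ⟨u', w'⟩ h' heq
    simp only [Finset.coe_filter, Finset.mem_product, Set.mem_ofPred_eq] at h h'
    simp only [Sym2.eq_iff] at heq
    rcases heq with ⟨rfl, rfl⟩ | ⟨rfl, rfl⟩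
    · rfl
    · exact absurd h'.1.2 (Finset.disjoint_left.mp hXY h.1.1)

theorem card_le_adjCount_of_not_arc (G : SimpleGraph V) {r : ℕ} {P : Fin r → Finset V}
    {i j : Fin r} (hij : i ≠ j) (h : ¬ Arc G P j i) : (P j).card ≤ adjCount G (P i) (P j) := by
  rw [adjCount_comm, Finset.card_eq_sum_ones]
  refine Finset.sum_le_sum fun v hv => ?_
  obtain ⟨u, hu, huv⟩ : ∃ u ∈ P i, G.Adj v u := by
    by_contra! hno
    exact h ⟨hij.symm, v, hv, hno⟩
  calc 1 = if G.Adj v u then 1 else 0 := by simp [huv]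
    _ ≤ _ := Finset.single_le_sum (f := fun u => if G.Adj v u then 1 else 0)
        (fun _ _ => Nat.zero_le _) hu

theorem card_eq_four {a b c d : Fin 8} (h : [a, b, c, d].Nodup) :
    ({a, b, c, d} : Finset (Fin 8)).card = 4 := by
  simpa using List.toFinset_card_of_nodup h

theorem card_eq_five {a b c d e : Fin 8} (h : [a, b, c, d, e].Nodup) :
    ({a, b, c, d, e} : Finset (Fin 8)).card = 5 := by
  simpa using List.toFinset_card_of_nodup h

theorem AEColoring.disjoint_biUnion [Fintype V] {G : SimpleGraph V} {x : V} {s : ℕ}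
    {P : Fin 8 → Finset V} (hP : AEColoring G x s P) (S : Finset (Fin 8)) :
    Disjoint (S.biUnion P) (Sᶜ.biUnion P) := by
  rw [Finset.disjoint_biUnion_left]
  intro i hi
  rw [Finset.disjoint_biUnion_right]
  intro j hj
  refine hP.1 i j ?_
  rintro rfl
  exact Finset.mem_compl.mp hj hi

theorem AEColoring.card_biUnion_add_card_biUnion_compl [Fintype V] {G : SimpleGraph V} {x : V}
    {s : ℕ} {P : Fin 8 → Finset V} (hP : AEColoring G x s P)
    (hcard : Fintype.card V = 8 * s) (S : Finset (Fin 8)) :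
    (S.biUnion P).card + (Sᶜ.biUnion P).card = 8 * s - 1 := by
  rw [← Finset.card_union_of_disjoint (hP.disjoint_biUnion S), ← hcard,
    ← Finset.card_univ, ← Finset.card_erase_of_mem (Finset.mem_univ x)]
  congr 1
  ext v
  simp only [Finset.mem_union, Finset.mem_biUnion, Finset.mem_compl, Finset.mem_erase,
    Finset.mem_univ, and_true]
  rw [← hP.2.1 v]
  constructor
  · rintro (⟨i, -, hi⟩ | ⟨i, -, hi⟩) <;> exact ⟨i, hi⟩
  · rintro ⟨i, hi⟩
    by_cases hS : i ∈ S
    · exact Or.inl ⟨i, hS, hi⟩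
    · exact Or.inr ⟨i, hS, hi⟩

theorem AEColoring.adjCount_biUnion [Fintype V] {G : SimpleGraph V} {x : V} {s : ℕ}
    {P : Fin 8 → Finset V} (hP : AEColoring G x s P) (S T : Finset (Fin 8)) :
    adjCount G (S.biUnion P) (T.biUnion P) = ∑ i ∈ S, ∑ j ∈ T, adjCount G (P i) (P j) := by
  have hd : ∀ S : Finset (Fin 8), (S : Set (Fin 8)).PairwiseDisjoint P :=
    fun S i _ j _ hij => hP.1 i j hij
  unfold adjCount
  rw [Finset.sum_biUnion (hd S)]
  refine Finset.sum_congr rfl fun i _ => ?_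
  rw [Finset.sum_comm, Finset.sum_biUnion (hd T)]
  exact Finset.sum_congr rfl fun j _ => Finset.sum_comm

/-- Four classes cannot send at least `s` edges to each of the four remaining classes. -/
theorem AEColoring.exists_arc_of_card_eq_four [Fintype V] {G : SimpleGraph V} {x : V} {s : ℕ}
    {P : Fin 8 → Finset V} (hP : AEColoring G x s P) (hs : 1 ≤ s)
    (hcard : Fintype.card V = 8 * s) (hbip : PlanarBipBound G) {S : Finset (Fin 8)}
    (hS : S.card = 4) (h0 : 0 ∈ S) :
    ∃ j ∉ S, ∃ i ∈ S, Arc G P j i ∧ (i ≠ 0 → Arc G P i j) := by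
  by_contra! hno
  have hdense : ∀ i ∈ S, ∀ j ∈ Sᶜ, s ≤ adjCount G (P i) (P j) := by
    intro i hi j hj
    have hjS := Finset.mem_compl.mp hj
    have hij : i ≠ j := by rintro rfl; exact hjS hi
    have hj0 : j ≠ 0 := by rintro rfl; exact hjS h0
    by_cases h : Arc G P j i
    · obtain ⟨hi0, h'⟩ := hno j hjS i hi h
      rw [adjCount_comm, ← hP.2.2.2.2 i hi0]
      exact card_le_adjCount_of_not_arc G hij.symm h'
    · rw [← hP.2.2.2.2 j hj0]
      exact card_le_adjCount_of_not_arc G hij h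
  have hT : Sᶜ.card = 4 := by rw [Finset.card_compl, hS]; rfl
  have hlow : 16 * s ≤ adjCount G (S.biUnion P) (Sᶜ.biUnion P) := by
    rw [hP.adjCount_biUnion]
    calc 16 * s = ∑ _i ∈ S, ∑ _j ∈ Sᶜ, s := by simp [hS, hT]; ring
      _ ≤ _ := Finset.sum_le_sum fun i hi => Finset.sum_le_sum fun j hj => hdense i hi j hj
  have hsum := hP.card_biUnion_add_card_biUnion_compl hcard S
  have hup := hbip _ _ (hP.disjoint_biUnion S) (by omega)
  have hle := adjCount_le_edgesBetween G (hP.disjoint_biUnion S)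
  omega

/-! ### Accessibility -/

theorem Arc.accessible {G : SimpleGraph V} {P : Fin 8 → Finset V} {i j : Fin 8}
    (h : Arc G P i j) (hj : Accessible G P j) : Accessible G P i :=
  Relation.ReflTransGen.head h hj

theorem accessible_zero (G : SimpleGraph V) (P : Fin 8 → Finset V) : Accessible G P 0 :=
  Relation.ReflTransGen.refl

theorem card_le_accCount {G : SimpleGraph V} {P : Fin 8 → Finset V} {S : Finset (Fin 8)}
    (hS : ∀ i ∈ S, Accessible G P i) : S.card ≤ accCount G P :=
  Finset.card_le_card fun i hi => by simpa using hS i hi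

/-- Some accessible class outside `S` has an arc into `S`. -/
theorem exists_arc_of_card_lt_accCount {G : SimpleGraph V} {P : Fin 8 → Finset V}
    {S : Finset (Fin 8)} (h0 : 0 ∈ S) (hS : S.card < accCount G P) :
    ∃ y ∉ S, ∃ z ∈ S, Arc G P y z := by
  obtain ⟨i, hi, hiS⟩ := Finset.exists_mem_notMem_of_card_lt_card hS
  have hacc : Accessible G P i := by simpa using hi
  clear hi
  revert hiS
  refine Relation.ReflTransGen.head_induction_on hacc (fun h => absurd h0 h) ?_
  intro y z hyz _ ih hy
  by_cases hz : z ∈ S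
  · exact ⟨y, hy, z, hz, hyz⟩
  · exact ih hz

theorem not_blocks_of_arc_zero {G : SimpleGraph V} {P : Fin 8 → Finset V} {i j : Fin 8}
    (hi : i ≠ 0) (h : Arc G P j 0) : ¬ Blocks G P i j := fun hb =>
  hb.2 (Relation.ReflTransGen.single ⟨h, hb.1.symm, hi.symm⟩)

theorem eq_of_blocks_of_arc_arc_zero {G : SimpleGraph V} {P : Fin 8 → Finset V} {i j p : Fin 8}
    (hi : i ≠ 0) (hjp : Arc G P j p) (hp : Arc G P p 0) (hb : Blocks G P i j) : i = p := by
  by_contra hip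
  exact hb.2 (.head ⟨hjp, hb.1.symm, Ne.symm hip⟩ (.single ⟨hp, Ne.symm hip, hi.symm⟩))

theorem not_blocks_zero (G : SimpleGraph V) (P : Fin 8 → Finset V) (i : Fin 8) :
    ¬ Blocks G P i 0 := fun hb => hb.2 .refl

theorem filter_accessible_eq {G : SimpleGraph V} {P : Fin 8 → Finset V} {S : Finset (Fin 8)}
    (hcount : accCount G P = 5) (hS : ∀ i ∈ S, Accessible G P i) (hS5 : S.card = 5) :
    (Finset.univ.filter fun i => Accessible G P i) = S := by
  refine (Finset.eq_of_subset_of_card_le (fun i hi => by simpa using hS i hi) ?_).symm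
  rw [hS5, ← hcount]
  rfl

theorem isNiceColoring_of_not_blocks_both [Fintype V] {G : SimpleGraph V} {x : V} {s : ℕ}
    {P : Fin 8 → Finset V} (hP : AEColoring G x s P) (hcount : accCount G P = 5)
    {a b c d : Fin 8} (hS : [0, a, b, c, d].Nodup)
    (ha : Arc G P a 0) (hb : Arc G P b 0) (hc : Accessible G P c) (hd : Accessible G P d)
    (hnot : ∀ i : Fin 8, i ≠ 0 → ¬ (Blocks G P i c ∧ Blocks G P i d)) :
    IsNiceColoring G x s P := by
  refine ⟨hP, hcount, fun i _ hi0 => ?_⟩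
  have h0 := accessible_zero G P
  have heq := filter_accessible_eq (S := {0, a, b, c, d}) hcount
    (by simp [h0, ha.accessible h0, hb.accessible h0, hc, hd]) (card_eq_five hS)
  have hmem : ∀ j, Accessible G P j → Blocks G P i j → j = c ∨ j = d := by
    intro j hj hbl
    have : j ∈ ({0, a, b, c, d} : Finset (Fin 8)) := by rw [← heq]; simpa using hj
    simp only [Finset.mem_insert, Finset.mem_singleton] at this
    rcases this with rfl | rfl | rfl | h
    · exact absurd hbl (not_blocks_zero G P i)
    · exact absurd hbl (not_blocks_of_arc_zero hi0 ha)
    · exact absurd hbl (not_blocks_of_arc_zero hi0 hb)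
    · exact h
  rw [Finset.card_le_one]
  intro j hj k hk
  simp only [Finset.mem_filter, Finset.mem_univ, true_and] at hj hk
  rcases hmem j hj.1 hj.2 with rfl | rfl <;> rcases hmem k hk.1 hk.2 with rfl | rfl
  · rfl
  · exact absurd ⟨hj.2, hk.2⟩ (hnot i hi0)
  · exact absurd ⟨hk.2, hj.2⟩ (hnot i hi0)
  · rfl

theorem isNiceColoring_of_three_arcs [Fintype V] {G : SimpleGraph V} {x : V} {s : ℕ}
    {P : Fin 8 → Finset V} (hP : AEColoring G x s P) (hcount : accCount G P = 5)
    {a b c : Fin 8} (hS : [0, a, b, c].Nodup)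
    (ha : Arc G P a 0) (hb : Arc G P b 0) (hc : Arc G P c 0) :
    IsNiceColoring G x s P := by
  have h0 := accessible_zero G P
  obtain ⟨d, hd, z, hz, hdz⟩ := exists_arc_of_card_lt_accCount (G := G) (P := P)
    (S := {0, a, b, c}) (by simp) (by rw [card_eq_four hS]; omega)
  have hzacc : Accessible G P z := by
    simp only [Finset.mem_insert, Finset.mem_singleton] at hz
    rcases hz with rfl | rfl | rfl | rfl
    exacts [h0, ha.accessible h0, hb.accessible h0, hc.accessible h0]
  refine isNiceColoring_of_not_blocks_both hP hcount (a := a) (b := b) (c := c) (d := d) ?_ ha hb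
    (hc.accessible h0) (hdz.accessible hzacc)
    fun i hi h => not_blocks_of_arc_zero hi hc h.1
  grind

theorem isNiceColoring_of_two_paths [Fintype V] {G : SimpleGraph V} {x : V} {s : ℕ}
    {P : Fin 8 → Finset V} (hP : AEColoring G x s P) (hcount : accCount G P = 5)
    {a b c d : Fin 8} (hS : [0, a, b, c, d].Nodup)
    (ha : Arc G P a 0) (hb : Arc G P b 0) (hca : Arc G P c a) (hdb : Arc G P d b) :
    IsNiceColoring G x s P := by
  have h0 := accessible_zero G P
  refine isNiceColoring_of_not_blocks_both hP hcount hS ha hb (hca.accessible (ha.accessible h0))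
    (hdb.accessible (hb.accessible h0)) fun i hi h => ?_
  have h1 := eq_of_blocks_of_arc_arc_zero hi hca ha h.1
  have h2 := eq_of_blocks_of_arc_arc_zero hi hdb hb h.2
  grind

/-! ### Moving a vertex into the small class -/

/-- Move `w` from the class `P a` to the small class `P 0`, and relabel so that
`P a \ {w}` becomes the small class. -/
noncomputable def moveToSmall (P : Fin 8 → Finset V) (a : Fin 8) (w : V) : Fin 8 → Finset V :=
  fun j => if j = 0 then (P a).erase w else if j = a then insert w (P 0) else P j

theorem moveToSmall_zero (P : Fin 8 → Finset V) (a : Fin 8) (w : V) :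
    moveToSmall P a w 0 = (P a).erase w := by simp [moveToSmall]

theorem moveToSmall_self (P : Fin 8 → Finset V) {a : Fin 8} (ha : a ≠ 0) (w : V) :
    moveToSmall P a w a = insert w (P 0) := by simp [moveToSmall, ha]

theorem moveToSmall_of_ne (P : Fin 8 → Finset V) {a j : Fin 8} (hj0 : j ≠ 0) (hja : j ≠ a)
    (w : V) : moveToSmall P a w j = P j := by simp [moveToSmall, hj0, hja]

theorem AEColoring.moveToSmall [Fintype V] {G : SimpleGraph V} {x : V} {s : ℕ} (hs : 1 ≤ s)
    {P : Fin 8 → Finset V} (hP : AEColoring G x s P) {a : Fin 8} (ha : a ≠ 0) {w : V}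
    (hw : w ∈ P a) (hfree : ∀ u ∈ P 0, ¬ G.Adj w u) :
    AEColoring G x s (moveToSmall P a w) := by
  obtain ⟨hdisj, hcover, hindep, h0, hne⟩ := hP
  have huniq : ∀ i j v, v ∈ P i → v ∈ P j → i = j := by
    intro i j v hi hj
    by_contra hij
    exact Finset.disjoint_left.mp (hdisj i j hij) hi hj
  have hmem : ∀ j v, v ∈ Equitable.moveToSmall P a w j ↔
      (v = w ∧ j = a) ∨ (v ≠ w ∧ v ∈ P (Equiv.swap 0 a j)) := by
    intro j v
    by_cases hj0 : j = 0
    · subst hj0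
      simp [moveToSmall_zero, ha.symm]
    by_cases hja : j = a
    · subst hja
      rw [moveToSmall_self P ha]
      simp only [Finset.mem_insert, Equiv.swap_apply_right]
      tauto
    · rw [moveToSmall_of_ne P hj0 hja, Equiv.swap_apply_of_ne_of_ne hj0 hja]
      have : v ∈ P j → v ≠ w := by rintro h rfl; exact hja (huniq _ _ _ h hw)
      tauto
  refine ⟨?_, ?_, ?_, ?_, ?_⟩
  · intro i j hij
    rw [Finset.disjoint_left]
    intro v hi hj
    rw [hmem] at hi hj
    rcases hi with ⟨rfl, rfl⟩ | ⟨hvi, hi⟩ <;> rcases hj with ⟨hv, rfl⟩ | ⟨hvj, hj⟩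
    · exact hij rfl
    · exact hvj rfl
    · exact hvi hv
    · exact hij ((Equiv.swap 0 a).injective (huniq _ _ _ hi hj))
  · intro v
    rw [← hcover v]
    constructor
    · rintro ⟨j, hj⟩
      rcases (hmem j v).mp hj with ⟨rfl, rfl⟩ | ⟨-, h⟩
      exacts [⟨_, hw⟩, ⟨_, h⟩]
    · rintro ⟨j, hj⟩
      by_cases hv : v = w
      · exact ⟨a, (hmem a v).mpr (Or.inl ⟨hv, rfl⟩)⟩
      · exact ⟨Equiv.swap 0 a j, (hmem _ v).mpr (Or.inr ⟨hv, by simpa using hj⟩)⟩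
  · intro j u hu v hv hadj
    rw [hmem] at hu hv
    rcases hu with ⟨rfl, rfl⟩ | ⟨-, hu⟩ <;> rcases hv with ⟨rfl, h⟩ | ⟨-, hv⟩
    · exact G.loopless.irrefl _ hadj
    · exact hfree v (by simpa using hv) hadj
    · exact hfree u (by simpa [h] using hu) hadj.symm
    · exact hindep _ u hu v hv hadj
  · rw [moveToSmall_zero, Finset.card_erase_of_mem hw, hne a ha]
  · intro j hj0
    by_cases hja : j = a
    · subst hja
      have hw0 : w ∉ P 0 := fun h => ha (huniq _ _ _ hw h)
      rw [moveToSmall_self P ha, Finset.card_insert_of_notMem hw0, h0]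
      omega
    · rw [moveToSmall_of_ne P hj0 hja, hne j hj0]

/-- An arc `a → 0` allows to exchange the roles of the classes `a` and `0`. -/
theorem AEColoring.exists_exchange [Fintype V] {G : SimpleGraph V} {x : V} {s : ℕ} (hs : 1 ≤ s)
    {P : Fin 8 → Finset V} (hP : AEColoring G x s P) {a : Fin 8} (ha : Arc G P a 0) :
    ∃ P' : Fin 8 → Finset V, AEColoring G x s P' ∧ Arc G P' a 0 ∧
      (∀ j, j ≠ 0 → Arc G P j a → Arc G P' j 0) ∧
      (∀ j, j ≠ 0 → Arc G P' j a → Arc G P j 0) ∧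
      ∀ j k, j ≠ 0 → j ≠ a → k ≠ 0 → k ≠ a → (Arc G P' j k ↔ Arc G P j k) := by
  obtain ⟨ha0, w, hw, hfree⟩ := ha
  refine ⟨Equitable.moveToSmall P a w, hP.moveToSmall hs ha0 hw hfree, ⟨ha0, w, ?_, ?_⟩, ?_, ?_, ?_⟩
  · rw [moveToSmall_self P ha0]
    exact Finset.mem_insert_self _ _
  · intro u hu
    rw [moveToSmall_zero] at hu
    exact hP.2.2.1 a w hw u (Finset.mem_of_mem_erase hu)
  · rintro j hj0 ⟨hja, v, hv, hva⟩
    refine ⟨hj0, v, by rwa [moveToSmall_of_ne P hj0 hja], fun u hu => hva u ?_⟩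
    rw [moveToSmall_zero] at hu
    exact Finset.mem_of_mem_erase hu
  · rintro j hj0 ⟨hja, v, hv, hva⟩
    rw [moveToSmall_of_ne P hj0 hja] at hv
    rw [moveToSmall_self P ha0] at hva
    exact ⟨hj0, v, hv, fun u hu => hva u (Finset.mem_insert_of_mem hu)⟩
  · intro j k hj0 hja hk0 hka
    unfold Arc
    rw [moveToSmall_of_ne P hj0 hja, moveToSmall_of_ne P hk0 hka]

/-! ### Configurations leading to nice colorings -/

theorem accCount_eq_five [Fintype V] {G : SimpleGraph V} {x : V} {s : ℕ}
    (hmax : ∀ P : Fin 8 → Finset V, AEColoring G x s P → accCount G P ≤ 5)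
    {P : Fin 8 → Finset V} (hP : AEColoring G x s P) {S : Finset (Fin 8)}
    (hS : ∀ i ∈ S, Accessible G P i) (hS5 : S.card = 5) : accCount G P = 5 :=
  le_antisymm (hmax P hP) (hS5 ▸ card_le_accCount hS)

/-- Two classes with arcs to a class that has an arc to the small class. -/
theorem exists_isNiceColoring_of_fork [Fintype V] {G : SimpleGraph V} {x : V} {s : ℕ}
    (hs : 1 ≤ s) (hcard : Fintype.card V = 8 * s) (hbip : PlanarBipBound G)
    (hmax : ∀ P : Fin 8 → Finset V, AEColoring G x s P → accCount G P ≤ 5)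
    {P : Fin 8 → Finset V} (hP : AEColoring G x s P) {a b c : Fin 8}
    (hS : [0, a, b, c].Nodup)
    (ha : Arc G P a 0) (hba : Arc G P b a) (hca : Arc G P c a) :
    ∃ P' : Fin 8 → Finset V, IsNiceColoring G x s P' := by
  obtain ⟨P', hP', ha', hto, -, -⟩ := hP.exists_exchange hs ha
  have hb0 : b ≠ 0 := by grind
  have hc0 : c ≠ 0 := by grind
  have hb' := hto b hb0 hba
  have hc' := hto c hc0 hca
  have h0 := accessible_zero G P'
  obtain ⟨y, hy, z, hz, hyz, -⟩ := hP'.exists_arc_of_card_eq_four hs hcard hbip (card_eq_four hS)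
    (by simp)
  have hacc : ∀ i ∈ ({0, a, b, c} : Finset (Fin 8)), Accessible G P' i := by
    simp [h0, ha'.accessible h0, hb'.accessible h0, hc'.accessible h0]
  refine ⟨P', isNiceColoring_of_three_arcs hP' (accCount_eq_five hmax hP'
    (S := insert y {0, a, b, c}) ?_ ?_) hS ha' hb' hc'⟩
  · intro i hi
    rcases Finset.mem_insert.mp hi with rfl | hi
    exacts [hyz.accessible (hacc z hz), hacc i hi]
  · rw [Finset.card_insert_of_notMem hy, card_eq_four hS]

/-- A path of three arcs to the small class, together with another class that has an arc to it. -/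
theorem exists_isNiceColoring_of_chain [Fintype V] {G : SimpleGraph V} {x : V} {s : ℕ}
    (hs : 1 ≤ s) (hcard : Fintype.card V = 8 * s) (hbip : PlanarBipBound G)
    (hmax : ∀ P : Fin 8 → Finset V, AEColoring G x s P → accCount G P ≤ 5)
    {P : Fin 8 → Finset V} (hP : AEColoring G x s P) {a b c d : Fin 8}
    (hS : [0, a, b, c, d].Nodup) (ha : Arc G P a 0) (hba : Arc G P b a) (hcb : Arc G P c b)
    (hd : Arc G P d 0) (hcd : ¬ Arc G P c d) :
    ∃ P' : Fin 8 → Finset V, IsNiceColoring G x s P' := by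
  obtain ⟨P', hP', ha', hto, -, hiff⟩ := hP.exists_exchange hs ha
  have hb' : Arc G P' b 0 := hto b (by grind) hba
  have hcb' : Arc G P' c b := (hiff c b (by grind) (by grind) (by grind) (by grind)).mpr hcb
  have h0 := accessible_zero G P
  have h0' := accessible_zero G P'
  have hcount : ∀ y, y ∉ ({0, a, b, c} : Finset (Fin 8)) → Accessible G P' y →
      accCount G P' = 5 := by
    intro y hy hacc
    refine accCount_eq_five hmax hP' (S := {0, a, b, c, y}) ?_ (card_eq_five (by grind))
    simp [h0', ha'.accessible h0', hb'.accessible h0', hcb'.accessible (hb'.accessible h0'), hacc]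
  by_cases hy0 : ∃ y ∉ ({0, a, b, c} : Finset (Fin 8)), Arc G P' y 0
  · obtain ⟨y, hy, hyarc⟩ := hy0
    exact ⟨P', isNiceColoring_of_three_arcs hP' (hcount y hy (hyarc.accessible h0'))
      (a := a) (b := b) (c := y) (by grind) ha' hb' hyarc⟩
  by_cases hya : ∃ y ∉ ({0, a, b, c} : Finset (Fin 8)), Arc G P' y a
  · obtain ⟨y, hy, hyarc⟩ := hya
    exact ⟨P', isNiceColoring_of_two_paths hP'
      (hcount y hy (hyarc.accessible (ha'.accessible h0')))
      (a := a) (b := b) (c := y) (d := c) (by grind) ha' hb' hyarc hcb'⟩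
  by_cases hyb : ∃ y ∉ ({0, a, b, c} : Finset (Fin 8)), Arc G P' y b
  · obtain ⟨y, hy, hyarc⟩ := hyb
    exact exists_isNiceColoring_of_fork hs hcard hbip hmax hP' (a := b) (b := c) (c := y)
      (by grind) hb' hcb' hyarc
  exfalso
  push Not at hy0 hya hyb
  obtain ⟨y, hy, z, hz, hyz, hzy⟩ := hP'.exists_arc_of_card_eq_four hs hcard hbip
    (S := {0, a, b, c}) (card_eq_four (by grind)) (by simp)
  have hzc : z = c := by grind
  subst hzc
  have hzy' := (hiff z y (by grind) (by grind) (by grind) (by grind)).mp (hzy (by grind))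
  have hyz' := (hiff y z (by grind) (by grind) (by grind) (by grind)).mp hyz
  have hyd : y ≠ d := by rintro rfl; exact hcd hzy'
  have hzacc := hcb.accessible (hba.accessible (ha.accessible h0))
  have hsix : (insert y {0, a, b, z, d} : Finset (Fin 8)).card ≤ accCount G P := by
    apply card_le_accCount
    simp [h0, ha.accessible h0, hba.accessible (ha.accessible h0), hzacc, hd.accessible h0,
      hyz'.accessible hzacc]
  rw [Finset.card_insert_of_notMem (by grind), card_eq_five hS] at hsix
  have := hmax P hP
  omega

/-- Two classes with arcs to the small class, one of which receives an arc. -/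
theorem exists_isNiceColoring_of_two_arcs [Fintype V] {G : SimpleGraph V} {x : V} {s : ℕ}
    (hs : 1 ≤ s) (hcard : Fintype.card V = 8 * s) (hbip : PlanarBipBound G)
    (hmax : ∀ P : Fin 8 → Finset V, AEColoring G x s P → accCount G P ≤ 5)
    {P : Fin 8 → Finset V} (hP : AEColoring G x s P) (hcount : accCount G P = 5)
    {a b c : Fin 8} (hS : [0, a, b, c].Nodup) (ha : Arc G P a 0) (hb : Arc G P b 0)
    (hca : Arc G P c a) : ∃ P' : Fin 8 → Finset V, IsNiceColoring G x s P' := by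
  obtain ⟨e, he, z, hz, hez⟩ := exists_arc_of_card_lt_accCount (G := G) (P := P)
    (S := {0, a, b, c}) (by simp) (by rw [card_eq_four hS]; omega)
  have hSe : [0, a, c, e, b].Nodup := by grind
  by_cases heb : Arc G P e b
  · exact ⟨P, isNiceColoring_of_two_paths hP hcount (a := a) (b := b) (c := c) (d := e)
      (by grind) ha hb hca heb⟩
  simp only [Finset.mem_insert, Finset.mem_singleton] at hz
  rcases hz with rfl | rfl | rfl | rfl
  · exact ⟨P, isNiceColoring_of_three_arcs hP hcount (a := a) (b := b) (c := e) (by grind)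
      ha hb hez⟩
  · exact exists_isNiceColoring_of_fork hs hcard hbip hmax hP (b := c) (c := e)
      (by grind) ha hca hez
  · exact absurd hez heb
  · exact exists_isNiceColoring_of_chain hs hcard hbip hmax hP hSe ha hca hez hb heb

/-- **Lemma 4.4.** Let `G` be a graph on `8s` vertices satisfying the planar bipartite
edge bound and `x` a vertex of `G`.  If some almost equitable coloring of `G − x` has
exactly `5` accessible classes and none has more, then there is an almost equitable
coloring of `G − x` with exactly `5` accessible classes that is nice: every accessible
class other than the small class blocks at most one accessible class. -/
theorem exists_nice_coloring (V : Type*) [Fintype V] (G : SimpleGraph V) (x : V)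
    (s : ℕ) (hs : 1 ≤ s) (hcard : Fintype.card V = 8 * s) (hbip : PlanarBipBound G)
    (hex : ∃ P : Fin 8 → Finset V, AEColoring G x s P ∧ accCount G P = 5)
    (hmax : ∀ P : Fin 8 → Finset V, AEColoring G x s P → accCount G P ≤ 5) :
    ∃ P : Fin 8 → Finset V, AEColoring G x s P ∧ accCount G P = 5 ∧
      ∀ i : Fin 8, Accessible G P i → i ≠ 0 →
        (Finset.univ.filter fun j : Fin 8 =>
          Accessible G P j ∧ Blocks G P i j).card ≤ 1 := by
  obtain ⟨P, hP, hcount⟩ := hex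
  obtain ⟨a, ha, z, hz, haz⟩ := exists_arc_of_card_lt_accCount (G := G) (P := P) (S := {0})
    (by simp) (by simp [hcount])
  obtain rfl := Finset.mem_singleton.mp hz
  by_cases htwo : ∃ b, b ≠ a ∧ Arc G P b 0
  · obtain ⟨b, hba, hb⟩ := htwo
    obtain ⟨c, hc, z, hz, hcz⟩ := exists_arc_of_card_lt_accCount (G := G) (P := P)
      (S := {0, a, b}) (by simp) (Finset.card_le_three.trans_lt (by omega))
    have hb0 := hb.1
    simp only [Finset.mem_insert, Finset.mem_singleton] at hz
    rcases hz with rfl | rfl | rfl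
    · exact ⟨P, isNiceColoring_of_three_arcs hP hcount (a := a) (b := b) (c := c) (by grind)
        haz hb hcz⟩
    · exact exists_isNiceColoring_of_two_arcs hs hcard hbip hmax hP hcount (b := b) (c := c)
        (by grind) haz hb hcz
    · exact exists_isNiceColoring_of_two_arcs hs hcard hbip hmax hP hcount (b := a) (c := c)
        (by grind) hb haz hcz
  push Not at htwo
  obtain ⟨b, hb, z, hz, hba⟩ := exists_arc_of_card_lt_accCount (G := G) (P := P)
    (S := {0, a}) (by simp) (Finset.card_le_two.trans_lt (by omega))
  obtain rfl : z = a := by grind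
  obtain ⟨c, hc, y, hy, hcb⟩ := exists_arc_of_card_lt_accCount (G := G) (P := P)
    (S := {0, z, b}) (by simp) (Finset.card_le_three.trans_lt (by omega))
  by_cases hcz : Arc G P c z
  · exact exists_isNiceColoring_of_fork hs hcard hbip hmax hP (b := b) (c := c)
      (by grind) haz hba hcz
  obtain rfl : y = b := by grind
  have hS : [0, z, y, c].Nodup := by grind
  obtain ⟨d, hd, e, he, hde⟩ := exists_arc_of_card_lt_accCount (G := G) (P := P)
    (S := {0, z, y, c}) (by simp) (by rw [card_eq_four hS]; omega)
  by_cases hdz : Arc G P d z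
  · exact exists_isNiceColoring_of_fork hs hcard hbip hmax hP (b := y) (c := d)
      (by grind) haz hba hdz
  obtain ⟨P', hP', hz', hto, hfrom, hiff⟩ := hP.exists_exchange hs haz
  have hy' : Arc G P' y 0 := hto y (by grind) hba
  have hcy' : Arc G P' c y := (hiff c y (by grind) (by grind) (by grind) (by grind)).mpr hcb
  have hde' : Arc G P' d e := (hiff d e (by grind) (by grind) (by grind) (by grind)).mpr hde
  have hey : e = y ∨ e = c := by grind
  rcases hey with rfl | rfl
  · exact exists_isNiceColoring_of_fork hs hcard hbip hmax hP' (b := c) (c := d)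
      (by grind) hy' hcy' hde'
  · exact exists_isNiceColoring_of_chain hs hcard hbip hmax hP' (by grind) hy' hcy' hde' hz'
      fun h => htwo d (by grind) (hfrom d (by grind) h)

end Equitable
end
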